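/- arXiv:2109.10216 — 10 statements merged into one kernel-verified Lean document; each statement's English description precedes it below -/
import Mathlib

section
/- Let a, b, c be linearly independent unit vectors in ℝ³ satisfying |⟪b,c⟫| < |⟪a,c⟫| ≤ |⟪a,b⟫| ≤ 1/2 (i.e. the angles between the corresponding lines satisfy 60° ≤ φ_AB ≤ φ_AC < φ_BC). Then the set of minimizers of J over the unit sphere is exactly {a, -a}. -/
open RealInnerProductSpace

noncomputable def dS (x y : EuclideanSpace ℝ (Fin 3)) : ℝ := Real.sqrt (1 - ⟪x, y⟫ ^ 2)

noncomputable def J (a b c p : EuclideanSpace ℝ (Fin 3)) : ℝ := dS a p + dS b p + dS c p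

def IsMinimizer (a b c p : EuclideanSpace ℝ (Fin 3)) : Prop :=
  ‖p‖ = 1 ∧ ∀ q : EuclideanSpace ℝ (Fin 3), ‖q‖ = 1 → J a b c p ≤ J a b c q

lemma cubic_aux (g b x : ℝ) (hg0 : 0 ≤ g) (hg : g ≤ 1/2) (hb0 : 0 ≤ b) (hb : b ≤ g^2) (hx : 0 ≤ x) :
    0 ≤ ((1-g)*x^2 + (2*(g^2+b)-1-2*g)*x+2)*(x+(g^2+b)) - b*(x+2)^2 := by
  have h1 : 0 ≤ x^2 - (1+3*g-2*g^2)*x + (2+2*g-4*g^2-8*g^3) := by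
    have : (1+3*g-2*g^2)^2 ≤ 4*(2+2*g-4*g^2-8*g^3) := by
      have : 4*(2+2*g-4*g^2-8*g^3) - (1+3*g-2*g^2)^2 = (1-2*g)*(7+16*g+11*g^2+2*g^3) := by ring
      have : 0 ≤ (1-2*g)*(7+16*g+11*g^2+2*g^3) := mul_nonneg (by linarith) (by positivity)
      linarith
    nlinarith [sq_nonneg (x - (1+3*g-2*g^2)/2)]
  have h2 : 0 ≤ x*(1-g)*(x^2 - (1+3*g-2*g^2)*x + (2+2*g-4*g^2-8*g^3)) :=
    mul_nonneg (mul_nonneg hx (by linarith)) h1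
  have h3 : 0 ≤ x*(1-g)*(x^2 - (1+3*g-2*g^2)*x + (2+2*g-4*g^2-8*g^3)) - g^2*((2-g)*x^2+(8*g^2-5-2*g)*x-2) := by
    have e : x*(1-g)*(x^2 - (1+3*g-2*g^2)*x + (2+2*g-4*g^2-8*g^3)) - g^2*((2-g)*x^2+(8*g^2-5-2*g)*x-2)
      = x*((1/2-g)*x^2 + (1/2)*(x-3/2)^2 + (1/2-2*g+3*g^2-g^3)*x + (7/8-g^2-2*g^3)) + 2*g^2 := by ring
    have k1 : 0 ≤ 1/2-2*g+3*g^2-g^3 := by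
      nlinarith [sq_nonneg (g-2/5), mul_nonneg (mul_self_nonneg (g-2/5)) (sub_nonneg.2 hg)]
    have k2 : 0 ≤ 7/8-g^2-2*g^3 := by nlinarith [mul_nonneg hg0 hg0]
    have k3 : 0 ≤ 1/2 - g := by linarith
    rw [e]
    positivity
  have h4 : ((1-g)*x^2 + (2*(g^2+b)-1-2*g)*x+2)*(x+(g^2+b)) - b*(x+2)^2 =
     x*(1-g)*(x^2 - (1+3*g-2*g^2)*x + (2+2*g-4*g^2-8*g^3)) - (g^2-b)*((2-g)*x^2+(8*g^2-5-2*g)*x-2) + 2*x*(g^2-b)^2 := by ring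
  rw [h4]
  have h5 : 0 ≤ 2*x*(g^2-b)^2 := by positivity
  rcases le_total ((2-g)*x^2+(8*g^2-5-2*g)*x-2) 0 with h | h
  · nlinarith [mul_nonneg (sub_nonneg.2 hb) (neg_nonneg.2 h)]
  · nlinarith [mul_nonneg hb0 h]

lemma first_pos (g b x : ℝ) (hg0 : 0 ≤ g) (hg : g ≤ 1/2) (hb0 : 0 ≤ b) (hx : 0 ≤ x) :
    0 ≤ (1-g)*x^2 + (2*(g^2+b)-1-2*g)*x+2 := by
  have : 0 ≤ b * x := by positivity
  have : 0 ≤ (1/2 - g)*x^2 := mul_nonneg (by linarith) (by positivity)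
  have : 0 ≤ (1/2-g)*(1/2-g)*x := by positivity
  nlinarith [sq_nonneg (x-2)]

-- k-version
lemma end_aux (g b k x : ℝ) (hg0 : 0 ≤ g) (hg : g ≤ 1/2) (hb0 : 0 ≤ b) (hb : b ≤ g^2) (hx : 0 ≤ x)
   (hk : k ≤ 4 - 2*(g^2+b)) :
    0 ≤ ((1-g)*x^2 + (3-2*g-k)*x+2)*(2*x+4-k) - 2*b*(x+2)^2 := by
  have h1 := cubic_aux g b x hg0 hg hb0 hb hx
  have h2 := first_pos g b x hg0 hg hb0 hx
  have h3 : ((1-g)*x^2 + (2*(g^2+b)-1-2*g)*x+2)*(2*(x+(g^2+b))) ≤ ((1-g)*x^2 + (3-2*g-k)*x+2)*(2*x+4-k) := by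
    apply mul_le_mul
    · nlinarith
    · linarith
    · positivity
    · nlinarith
  nlinarith

lemma det_id (S T R g β k : ℝ) (h : S + T + R = 1) :
   (T+R-k*T*R)*(S+R-k*S*R)*(S+T-k*S*T) - 2*g*β^2*(S*T*R) - β^2*S^2*(T+R-k*T*R) - β^2*T^2*(S+R-k*S*R)
     - g^2*R^2*(S+T-k*S*T) =
   -k*(S*T*(1-k*R)+R*(1-R))^2 + (S*T*(1-k*R)+R*(1-R))*((1-β^2)*(1-R) + (1-g^2)*R) - (1-2*β^2-g^2+2*g*β^2)*(R*(S*T)) := by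
  obtain rfl : S = 1 - T - R := by linarith
  ring

set_option maxHeartbeats 2000000 in
lemma det_nonneg (S T R g β c d : ℝ) (hS : 0 < S) (hT : 0 < T) (hR : 0 < R) (h : S + T + R = 1)
    (hβ : 0 ≤ β) (hβg : β ≤ g) (hg : g ≤ 1/2) (hc : c^2 = 1-g^2) (hd : d^2 = 1 - β^2) :
   0 ≤ (T+R-(c+d)^2*T*R)*(S+R-(c+d)^2*S*R)*(S+T-(c+d)^2*S*T) - 2*g*β^2*(S*T*R) - β^2*S^2*(T+R-(c+d)^2*T*R) - β^2*T^2*(S+R-(c+d)^2*S*R)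
     - g^2*R^2*(S+T-(c+d)^2*S*T) := by
  rw [det_id _ _ _ _ _ _ h]
  have hk : (c+d)^2 ≤ 4 - 2*(g^2+β^2) := by nlinarith [sq_nonneg (c-d)]
  have F0 : 0 ≤ -(c+d)^2*(R*(1-R))^2 + (R*(1-R))*((1-β^2)*(1-R) + (1-g^2)*R) := by
    have : -(c+d)^2*(R*(1-R))^2 + (R*(1-R))*((1-β^2)*(1-R) + (1-g^2)*R) = R*(1-R)*(d*(1-R) - c*R)^2 := by
      rw [← hc, ← hd]; ring
    rw [this]
    have : 0 < 1 - R := by linarith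
    positivity
  have hk0 : 0 ≤ (c+d)^2 := sq_nonneg _
  generalize (c+d)^2 = k at *
  have F1 : 0 ≤ -k*(((1-R)^2/4)*(1-k*R)+R*(1-R))^2 + (((1-R)^2/4)*(1-k*R)+R*(1-R))*((1-β^2)*(1-R) + (1-g^2)*R) - (1-2*β^2-g^2+2*g*β^2)*(R*((1-R)^2/4)) := by
    obtain ⟨s, hs⟩ : ∃ s, s = (1-R)/2 := ⟨_, rfl⟩
    have hs0 : 0 < s := by rw [hs]; linarith
    have hid := det_id s s R g β k (by rw [hs]; ring)
    have hss : s * s = (1-R)^2/4 := by rw [hs]; ring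
    rw [hss] at hid
    rw [← hid, ← hss]
    have e : (s + R - k * s * R) * (s + R - k * s * R) * (s + s - k * s * s) - 2 * g * β ^ 2 * (s*s * R) -
        β ^ 2 * s ^ 2 * (s + R - k * s * R) - β ^ 2 * s ^ 2 * (s + R - k * s * R) - g ^ 2 * R ^ 2 * (s + s - k * s * s)
        = s * (s+R-k*s*R + g*R) * ((s+R-k*s*R-g*R)*(2-k*s) - 2*β^2*s) := by ring
    rw [e]
    have hsum : 2*s + R = 1 := by rw [hs]; ring
    have hE : s + R - k*s*R = (s-R)^2 + (4-k)*s*R + s * R + (s * (1 - s - R)) := by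
      obtain rfl : R = 1 - 2*s := by linarith
      ring
    have hE0 : 0 ≤ s + R - k*s*R := by
      rw [hE]
      have : 0 ≤ 4 - k := by nlinarith [sq_nonneg g, sq_nonneg β]
      have : 0 ≤ 1 - s - R := by linarith
      positivity
    refine mul_nonneg (mul_nonneg hs0.le (add_nonneg hE0 (mul_nonneg (by linarith) hR.le))) ?_
    have hx := end_aux g (β^2) k (R/s) (by linarith) hg (sq_nonneg _) (by nlinarith) (by positivity) hk
    have : (s+R-k*s*R-g*R)*(2-k*s) - 2*β^2*s = s^3 * (((1-g)*(R/s)^2 + (3-2*g-k)*(R/s)+2)*(2*(R/s)+4-k) - 2*β^2*((R/s)+2)^2) := by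
      have e2 : s^3 * (((1-g)*(R/s)^2 + (3-2*g-k)*(R/s)+2)*(2*(R/s)+4-k) - 2*β^2*((R/s)+2)^2)
         = ((1-g)*R^2 + (3-2*g-k)*(R*s)+2*s^2)*(2*R+4*s-k*s) - 2*β^2*s*(R+2*s)^2 := by
        field_simp
      rw [e2]
      obtain rfl : R = 1 - 2*s := by linarith
      ring
    rw [this]
    positivity
  have hp1 : 0 < (1-R)^2/4 := by
    have : 0 < 1 - R := by linarith
    positivity
  have hp : S*T ≤ (1-R)^2/4 := by
    have : 1 - R = S + T := by linarith
    rw [this]; nlinarith [sq_nonneg (S-T)]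
  have hp0 : 0 < S*T := by positivity
  generalize S*T = p at *
  generalize (1-R)^2/4 = q at *
  refine nonneg_of_mul_nonneg_right (a := q) ?_ hp1
  have e : q * (-k * (p * (1 - k * R) + R * (1 - R)) ^ 2 +
        (p * (1 - k * R) + R * (1 - R)) * ((1 - β ^ 2) * (1 - R) + (1 - g ^ 2) * R) -
      (1 - 2 * β ^ 2 - g ^ 2 + 2 * g * β ^ 2) * (R * p)) =
      (q - p) * (-k*(R*(1-R))^2 + (R*(1-R))*((1-β^2)*(1-R) + (1-g^2)*R)) +
      p * (-k * (q * (1 - k * R) + R * (1 - R)) ^ 2 +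
        (q * (1 - k * R) + R * (1 - R)) * ((1 - β ^ 2) * (1 - R) + (1 - g ^ 2) * R) -
      (1 - 2 * β ^ 2 - g ^ 2 + 2 * g * β ^ 2) * (R * q)) + k*(1-k*R)^2*p*(q-p)*q := by ring
  rw [e]
  have := sub_nonneg.2 hp
  positivity

lemma minor_pos (S T R β k : ℝ) (hS : 0 < S) (hT : 0 < T) (hR : 0 < R) (h : S + T + R = 1)
    (hβ : 0 < β) (hβ2 : β ≤ 1/2) (hk : k ≤ 4 - 4*β^2) :
    β^2*T^2 < (T+R-k*T*R)*(S+T-k*S*T) := by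
  have e : (T+R-k*T*R)*(S+T-k*S*T) - β^2*T^2 = S*R*(1-k*T)^2 + T*(1 - k*T*(1-T) - β^2*T) := by
    obtain rfl : S = 1 - T - R := by linarith
    ring
  have hT1 : 0 < 1 - T := by linarith
  have h1 : 0 < 1 - k*T*(1-T) - β^2*T := by
    have : 0 ≤ (4 - 4*β^2 - k) * (T*(1-T)) := mul_nonneg (by linarith) (by positivity)
    have hb : β^2 ≤ 1/4 := by nlinarith
    have h2 : 1 - (4-4*β^2)*(T*(1-T)) - β^2*T = (1-2*T)^2 + β^2*(3*T-4*T^2) := by ring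
    have h3 : 0 < (1-2*T)^2 + β^2*(3*T-4*T^2) := by
      rcases le_or_gt (3*T-4*T^2) 0 with h | h
      · nlinarith
      · positivity
    nlinarith
  have h2 : 0 ≤ S*R*(1-k*T)^2 := by positivity
  have h3 : 0 < T*(1 - k*T*(1-T) - β^2*T) := by positivity
  linarith

lemma psd_aux (A B C g β x y z : ℝ) (hA : 0 < A) (hm : β^2 < A*C)
    (hdet : 0 ≤ A*B*C - 2*g*β^2 - A*β^2 - B*β^2 - C*g^2) :
    0 ≤ A*x^2+B*y^2+C*z^2 - 2*g*(x*y) - 2*β*(x*z) - 2*β*(y*z) := by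
  have hm' : 0 < A*C-β^2 := by linarith
  refine nonneg_of_mul_nonneg_right (a := A*(A*C-β^2)) ?_ (by positivity)
  have e : A*(A*C-β^2)*(A*x^2+B*y^2+C*z^2 - 2*g*(x*y) - 2*β*(x*z) - 2*β*(y*z)) =
    (A*C-β^2)*(A*x-g*y-β*z)^2 + ((A*C-β^2)*z - (A*β+g*β)*y)^2 + A*(A*B*C - 2*g*β^2 - A*β^2 - B*β^2 - C*g^2)*y^2 := by ring
  rw [e]
  positivity

lemma form_nonneg (S T R g β c d x y z : ℝ) (hS : 0 < S) (hT : 0 < T) (hR : 0 < R) (h : S + T + R = 1)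
    (hβ : 0 < β) (hβg : β ≤ g) (hg : g ≤ 1/2) (hc : c^2 = 1-g^2) (hd : d^2 = 1 - β^2) :
    0 ≤ S*(1/T+1/R-(c+d)^2)*x^2+T*(1/S+1/R-(c+d)^2)*y^2+R*(1/S+1/T-(c+d)^2)*z^2
      - 2*g*(x*y) - 2*β*(x*z) - 2*β*(y*z) := by
  have hdet := det_nonneg S T R g β c d hS hT hR h hβ.le hβg hg hc hd
  have hk : (c+d)^2 ≤ 4 - 4*β^2 := by nlinarith [sq_nonneg (c-d)]
  have hmin := minor_pos S T R β ((c+d)^2) hS hT hR h hβ (by linarith) hk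
  generalize (c+d)^2 = k at *
  have eA : S*(1/T+1/R-k) = S*(T+R-k*T*R)/(T*R) := by field_simp; ring
  have eB : T*(1/S+1/R-k) = T*(S+R-k*S*R)/(S*R) := by field_simp; ring
  have eC : R*(1/S+1/T-k) = R*(S+T-k*S*T)/(S*T) := by field_simp; ring
  apply psd_aux
  · rw [eA]
    have : 0 < T+R-k*T*R := by
      have e : T+R-k*T*R = (T-R)^2 + (4-k)*(T*R) + S*(T+R) := by
        obtain rfl : S = 1 - T - R := by linarith
        ring
      rw [e]
      have : 0 < 4 - k := by nlinarith
      positivity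
    positivity
  · have : S*(1/T+1/R-k)*(R*(1/S+1/T-k)) = (T+R-k*T*R)*(S+T-k*S*T)/T^2 := by
      rw [eA, eC]; field_simp
    rw [this, lt_div_iff₀ (by positivity)]
    exact hmin
  · have : S*(1/T+1/R-k)*(T*(1/S+1/R-k))*(R*(1/S+1/T-k)) - 2*g*β^2 - S*(1/T+1/R-k)*β^2 - T*(1/S+1/R-k)*β^2 - R*(1/S+1/T-k)*g^2
      = ((T+R-k*T*R)*(S+R-k*S*R)*(S+T-k*S*T) - 2*g*β^2*(S*T*R) - β^2*S^2*(T+R-k*T*R) - β^2*T^2*(S+R-k*S*R)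
     - g^2*R^2*(S+T-k*S*T))/(S*T*R) := by
      rw [eA, eB, eC]; field_simp
    rw [this]
    positivity

lemma main_aux (a b c p : EuclideanSpace ℝ (Fin 3)) (s t r C D : ℝ)
    (ha : ‖a‖ = 1) (hb : ‖b‖ = 1) (hc : ‖c‖ = 1) (hp : ‖p‖ = 1)
    (h1 : |⟪b, c⟫| < |⟪a, c⟫|) (h2 : |⟪a, c⟫| ≤ |⟪a, b⟫|) (h3 : |⟪a, b⟫| ≤ 1 / 2)
    (hs : 0 < s) (ht : 0 < t) (hr : 0 < r)
    (hs2 : s^2 = 1 - ⟪a, p⟫^2) (ht2 : t^2 = 1 - ⟪b, p⟫^2) (hr2 : r^2 = 1 - ⟪c, p⟫^2)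
    (hC : C^2 = 1 - ⟪a, b⟫^2) (hD : D^2 = 1 - ⟪a, c⟫^2)
    (hy : ⟪b, p⟫ ≠ 0) (hz : ⟪c, p⟫ ≠ 0) : C + D < s + t + r := by
  set σ := s + t + r with hσ
  have hσ0 : 0 < σ := by positivity
  have hβ : 0 < |⟪a, c⟫| := lt_of_le_of_lt (abs_nonneg _) h1
  have hq : ∀ u v w : ℝ, (u * ⟪a, p⟫ + v * ⟪b, p⟫ + w * ⟪c, p⟫)^2 ≤
      u^2 + v^2 + w^2 + 2*⟪a, b⟫*(u*v) + 2*⟪a, c⟫*(u*w) + 2*⟪b, c⟫*(v*w) := by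
    intro u v w
    have h := real_inner_mul_inner_self_le (u • a + v • b + w • c) p
    have e1 : ⟪u • a + v • b + w • c, p⟫ = u * ⟪a, p⟫ + v * ⟪b, p⟫ + w * ⟪c, p⟫ := by
      simp only [inner_add_left, real_inner_smul_left]
    have e2 : ⟪u • a + v • b + w • c, u • a + v • b + w • c⟫ =
      u^2 + v^2 + w^2 + 2*⟪a, b⟫*(u*v) + 2*⟪a, c⟫*(u*w) + 2*⟪b, c⟫*(v*w) := by
      simp only [inner_add_left, inner_add_right, real_inner_smul_left, real_inner_smul_right,
        real_inner_self_eq_norm_sq, norm_smul, mul_pow, Real.norm_eq_abs, sq_abs, ha, hb, hc, real_inner_comm a b, real_inner_comm a c,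
        real_inner_comm b c]
      ring
    rw [e1, e2, real_inner_self_eq_norm_sq, hp] at h
    linarith
  have hf := form_nonneg (s/σ) (t/σ) (r/σ) |⟪a, b⟫| |⟪a, c⟫| C D |⟪a, p⟫/s| |⟪b, p⟫/t| |⟪c, p⟫/r|
    (by positivity) (by positivity) (by positivity) (by field_simp; linarith) hβ h2 h3
    (by rw [sq_abs]; exact hC) (by rw [sq_abs]; exact hD)
  have hq' := hq (⟪a, p⟫/s) (⟪b, p⟫/t) (⟪c, p⟫/r)
  have k1 : ⟪a, b⟫*(⟪a, p⟫/s*(⟪b, p⟫/t)) ≤ |⟪a, b⟫| * (|⟪a, p⟫/s| * |⟪b, p⟫/t|) := by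
    rw [← abs_mul, ← abs_mul]; exact le_abs_self _
  have k2 : ⟪a, c⟫*(⟪a, p⟫/s*(⟪c, p⟫/r)) ≤ |⟪a, c⟫| * (|⟪a, p⟫/s| * |⟪c, p⟫/r|) := by
    rw [← abs_mul, ← abs_mul]; exact le_abs_self _
  have k3 : ⟪b, c⟫*(⟪b, p⟫/t*(⟪c, p⟫/r)) < |⟪a, c⟫| * (|⟪b, p⟫/t| * |⟪c, p⟫/r|) := by
    refine lt_of_le_of_lt (le_abs_self _) ?_
    rw [abs_mul, abs_mul]
    exact mul_lt_mul_of_pos_right h1 (by positivity)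
  simp only [sq_abs] at hf
  generalize ⟪a, p⟫ = x at *
  generalize ⟪b, p⟫ = y at *
  generalize ⟪c, p⟫ = z at *
  obtain ⟨W, hW⟩ : ∃ W, W = x/s*x + y/t*y + z/r*z := ⟨_, rfl⟩
  have hW0 : 0 < W := by
    have e : W = x^2/s + y^2/t + z^2/r := by rw [hW]; ring
    rw [e]; positivity
  have hWs : W = 1/s + 1/t + 1/r - σ := by
    have e1 : x/s*x = 1/s - s := by field_simp; linarith
    have e2 : y/t*y = 1/t - t := by field_simp; linarith
    have e3 : z/r*z = 1/r - r := by field_simp; linarith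
    rw [hW, e1, e2, e3, hσ]; ring
  have key : W^2 < W*(1/s+1/t+1/r - (C+D)^2/σ) := by
    have e : W*(1/s+1/t+1/r - (C+D)^2/σ) =
      s / σ * (1 / (t / σ) + 1 / (r / σ) - (C + D) ^ 2) * (x / s) ^ 2 +
              t / σ * (1 / (s / σ) + 1 / (r / σ) - (C + D) ^ 2) * (y / t) ^ 2 +
            r / σ * (1 / (s / σ) + 1 / (t / σ) - (C + D) ^ 2) * (z / r) ^ 2
        + ((x/s)^2 + (y/t)^2 + (z/r)^2) := by
      rw [hW]
      clear_value σ
      field_simp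
      ring
    rw [← hW] at hq'
    rw [e]
    linarith
  have k4 : W < 1/s+1/t+1/r - (C+D)^2/σ := by
    rw [sq] at key
    exact lt_of_mul_lt_mul_left key hW0.le
  have k5 : (C+D)^2/σ < σ := by linarith
  rw [div_lt_iff₀ hσ0] at k5
  exact lt_of_pow_lt_pow_left₀ 2 hσ0.le (by linarith [k5, sq σ])

lemma dS_sq (a b : EuclideanSpace ℝ (Fin 3)) (ha : ‖a‖ = 1) (hb : ‖b‖ = 1) :
    (dS a b)^2 = 1 - ⟪a, b⟫^2 := by
  have h := real_inner_mul_inner_self_le a b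
  rw [real_inner_self_eq_norm_sq, real_inner_self_eq_norm_sq, ha, hb] at h
  exact Real.sq_sqrt (by linarith)

lemma dS_comm (a b : EuclideanSpace ℝ (Fin 3)) : dS a b = dS b a := by
  unfold dS; rw [real_inner_comm]

lemma dS_nonneg (a b : EuclideanSpace ℝ (Fin 3)) : 0 ≤ dS a b := Real.sqrt_nonneg _

lemma dS_neg (a b : EuclideanSpace ℝ (Fin 3)) : dS a (-b) = dS a b := by
  unfold dS; simp

lemma dS_self (a : EuclideanSpace ℝ (Fin 3)) (ha : ‖a‖ = 1) : dS a a = 0 := by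
  unfold dS; rw [real_inner_self_eq_norm_sq, ha]; simp

lemma dS_zero (a p : EuclideanSpace ℝ (Fin 3)) (ha : ‖a‖ = 1) (hp : ‖p‖ = 1) (h : dS a p = 0) :
    p = a ∨ p = -a := by
  have h2 := dS_sq a p ha hp
  rw [h] at h2
  have : (⟪a, p⟫ - 1) * (⟪a, p⟫ + 1) = 0 := by linarith
  rcases mul_eq_zero.1 this with h | h
  · left
    exact ((inner_eq_one_iff_of_norm_eq_one (𝕜 := ℝ) ha hp).1 (by linarith)).symm
  · right
    have : ⟪a, -p⟫ = 1 := by rw [inner_neg_right]; linarith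
    rw [(inner_eq_one_iff_of_norm_eq_one (𝕜 := ℝ) ha (by simpa using hp)).1 this, neg_neg]

lemma dS_lt (a b c d : EuclideanSpace ℝ (Fin 3)) (ha : ‖a‖ = 1) (hb : ‖b‖ = 1)
    (hc : ‖c‖ = 1) (hd : ‖d‖ = 1) (h : |⟪a, b⟫| < |⟪c, d⟫|) : dS c d < dS a b := by
  apply lt_of_pow_lt_pow_left₀ 2 (dS_nonneg _ _)
  rw [dS_sq _ _ ha hb, dS_sq _ _ hc hd]
  have := sq_lt_sq.2 h
  linarith

lemma dS_triangle (a b p : EuclideanSpace ℝ (Fin 3)) (ha : ‖a‖ = 1) (hb : ‖b‖ = 1)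
    (hp : ‖p‖ = 1) : dS a b ≤ dS a p + dS b p := by
  have hs := dS_sq a p ha hp
  have ht := dS_sq b p hb hp
  have hu := dS_sq a b ha hb
  have hs0 := dS_nonneg a p
  have ht0 := dS_nonneg b p
  have hu0 := dS_nonneg a b
  have h := real_inner_mul_inner_self_le (a - ⟪a, p⟫ • p) (b - ⟪b, p⟫ • p)
  have e1 : ⟪a - ⟪a, p⟫ • p, b - ⟪b, p⟫ • p⟫ = ⟪a, b⟫ - ⟪a, p⟫ * ⟪b, p⟫ := by
    simp only [inner_sub_left, inner_sub_right, real_inner_smul_left, real_inner_smul_right,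
        real_inner_self_eq_norm_sq, norm_smul, mul_pow, Real.norm_eq_abs, sq_abs, hp, real_inner_comm b p]
    ring
  have e2 : ⟪a - ⟪a, p⟫ • p, a - ⟪a, p⟫ • p⟫ = 1 - ⟪a, p⟫^2 := by
    simp only [inner_sub_left, inner_sub_right, real_inner_smul_left, real_inner_smul_right,
        real_inner_self_eq_norm_sq, norm_smul, mul_pow, Real.norm_eq_abs, sq_abs, hp, ha, real_inner_comm a p]
    ring
  have e3 : ⟪b - ⟪b, p⟫ • p, b - ⟪b, p⟫ • p⟫ = 1 - ⟪b, p⟫^2 := by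
    simp only [inner_sub_left, inner_sub_right, real_inner_smul_left, real_inner_smul_right,
        real_inner_self_eq_norm_sq, norm_smul, mul_pow, Real.norm_eq_abs, sq_abs, hp, hb, real_inner_comm b p]
    ring
  rw [e1, e2, e3, ← hs, ← ht] at h
  generalize dS a p = s at *
  generalize dS b p = t at *
  generalize dS a b = u at *
  generalize ⟪a, p⟫ = x at *
  generalize ⟪b, p⟫ = y at *
  generalize ⟪a, b⟫ = g at *
  have h4 : |g - x*y| ≤ s*t := abs_le_of_sq_le_sq (by linarith [mul_pow s t 2]) (by positivity)
  have hg : |g| ≤ 1 := abs_le_one_iff_mul_self_le_one.2 (by nlinarith [sq_nonneg u])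
  have h5 : g*(x*y-g) ≤ s*t := by
    refine (le_abs_self _).trans ?_
    rw [abs_mul, abs_sub_comm]
    nlinarith [abs_nonneg (g-x*y), abs_nonneg g]
  apply le_of_sq_le_sq _ (by positivity)
  nlinarith

lemma J_lt (a b c p : EuclideanSpace ℝ (Fin 3))
    (ha : ‖a‖ = 1) (hb : ‖b‖ = 1) (hc : ‖c‖ = 1) (hp : ‖p‖ = 1)
    (h1 : |⟪b, c⟫| < |⟪a, c⟫|) (h2 : |⟪a, c⟫| ≤ |⟪a, b⟫|) (h3 : |⟪a, b⟫| ≤ 1 / 2)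
    (hpa : ¬ (p = a ∨ p = -a)) : J a b c a < J a b c p := by
  have hJa : J a b c a = dS a b + dS a c := by
    unfold J; rw [dS_self a ha, dS_comm b a, dS_comm c a]; ring
  have hβ : 0 < |⟪a, c⟫| := lt_of_le_of_lt (abs_nonneg _) h1
  have hlt1 : ∀ u v : EuclideanSpace ℝ (Fin 3), ‖u‖ = 1 → ‖v‖ = 1 → 0 < |⟪u, v⟫| → dS u v < 1 := by
    intro u v hu hv h
    have := dS_sq u v hu hv
    have h' := sq_pos_of_pos h
    rw [sq_abs] at h'
    nlinarith [dS_nonneg u v]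
  have hone : ∀ u v : EuclideanSpace ℝ (Fin 3), ⟪u, v⟫ = 0 → dS u v = 1 := by
    intro u v h; unfold dS; rw [h]; simp
  rw [hJa]
  have hs : 0 < dS a p := lt_of_le_of_ne (dS_nonneg _ _) fun h => hpa (dS_zero a p ha hp h.symm)
  rcases (dS_nonneg b p).eq_or_lt with ht | ht
  · have hbc := dS_lt b c a c hb hc ha hc h1
    have e : J a b c p = dS a b + dS b c := by
      unfold J
      rcases dS_zero b p hb hp ht.symm with rfl | rfl
      · rw [dS_self p hb, dS_comm c p]; ring
      · rw [dS_neg, dS_neg, dS_neg, dS_self b hb, dS_comm c b]; ring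
    linarith
  rcases (dS_nonneg c p).eq_or_lt with hr | hr
  · have hbc := dS_lt b c a b hb hc ha hb (h1.trans_le h2)
    have e : J a b c p = dS a c + dS b c := by
      unfold J
      rcases dS_zero c p hc hp hr.symm with rfl | rfl
      · rw [dS_self p hc]; ring
      · rw [dS_neg, dS_neg, dS_neg, dS_self c hc]; ring
    linarith
  unfold J
  by_cases hy : ⟪b, p⟫ = 0
  · rw [hone b p hy]
    have := dS_triangle a c p ha hc hp
    have := hlt1 a b ha hb (hβ.trans_le h2)
    linarith
  by_cases hz : ⟪c, p⟫ = 0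
  · rw [hone c p hz]
    have := dS_triangle a b p ha hb hp
    have := hlt1 a c ha hc hβ
    linarith
  exact main_aux a b c p _ _ _ _ _ ha hb hc hp h1 h2 h3 hs ht hr (dS_sq _ _ ha hp) (dS_sq _ _ hb hp)
    (dS_sq _ _ hc hp) (dS_sq _ _ ha hb) (dS_sq _ _ ha hc) hy hz

theorem stmt0 (a b c : EuclideanSpace ℝ (Fin 3))
    (ha : ‖a‖ = 1) (hb : ‖b‖ = 1) (hc : ‖c‖ = 1)
    (hli : LinearIndependent ℝ ![a, b, c])
    (h1 : |⟪b, c⟫| < |⟪a, c⟫|) (h2 : |⟪a, c⟫| ≤ |⟪a, b⟫|) (h3 : |⟪a, b⟫| ≤ 1 / 2) :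
    {p : EuclideanSpace ℝ (Fin 3) | IsMinimizer a b c p} = {a, -a} := by
  have hneg : J a b c (-a) = J a b c a := by
    unfold J; rw [dS_neg, dS_neg, dS_neg]
  have hmin : ∀ q : EuclideanSpace ℝ (Fin 3), ‖q‖ = 1 → J a b c a ≤ J a b c q := by
    intro q hq
    by_cases h : q = a ∨ q = -a
    · rcases h with rfl | rfl
      · exact le_rfl
      · exact hneg.ge
    · exact (J_lt a b c q ha hb hc hq h1 h2 h3 h).le
  ext p
  simp only [Set.mem_ofPred_eq, Set.mem_insert_iff, Set.mem_singleton_iff]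
  constructor
  · rintro ⟨hp, hm⟩
    by_contra h
    exact absurd (hm a ha) (not_le.2 (J_lt a b c p ha hb hc hp h1 h2 h3 h))
  · rintro (rfl | rfl)
    · exact ⟨ha, hmin⟩
    · exact ⟨by simpa using ha, fun q hq => hneg.le.trans (hmin q hq)⟩
end

section
/- Let a, b, c be linearly independent unit vectors in ℝ³ with ⟪a,b⟫ = ⟪a,c⟫ = ⟪b,c⟫ = z for some real z with 0 < z < 1/2 (an equilateral configuration with common angle φ = arccos z strictly between 60° and 90°). Then the set of minimizers of J over the unit sphere is exactly {a, -a, b, -b, c, -c}. -/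
open RealInnerProductSpace

/-- Two lower bounds for a product of two of the distances. -/
lemma prod_bound (z α β γ X Y : ℝ) (hz0 : 0 < z)
    (hX0 : 0 ≤ X) (hY0 : 0 ≤ Y)
    (hX : X ^ 2 = (1 - z) * ((1 + z) * (β ^ 2 + γ ^ 2) + 2 * z * (β * γ)))
    (hY : Y ^ 2 = (1 - z) * ((1 + z) * (α ^ 2 + γ ^ 2) + 2 * z * (α * γ))) :
    (1 - z) * ((1 + z) * (γ ^ 2 + α * β) + z * (γ * (α + β))) ≤ X * Y ∧
    (1 - z) * (((1 + z) * γ + z * β) * ((1 + z) * γ + z * α) - (1 + 2 * z) * (α * β))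
      ≤ (1 + z) * (X * Y) := by
  have hXY : (X * Y) ^ 2 = (1 - z) ^ 2 * (((1 + z) * (γ ^ 2 + α * β) + z * (γ * (α + β))) ^ 2
      + (1 + 2 * z) * (γ * (α - β)) ^ 2) := by
    rw [mul_pow, hX, hY]; ring
  have hnn : 0 ≤ X * Y := mul_nonneg hX0 hY0
  constructor
  · apply (abs_le_of_sq_le_sq' _ hnn).2
    rw [hXY]
    have : 0 ≤ (1 - z) ^ 2 * ((1 + 2 * z) * (γ * (α - β)) ^ 2) := by positivity
    linarith
  · apply (abs_le_of_sq_le_sq' _ (by positivity : 0 ≤ (1 + z) * (X * Y))).2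
    rw [mul_pow (1 + z) (X * Y), hXY]
    have : 0 ≤ (1 - z) ^ 2 * ((1 + 2 * z) *
      (((1 + z) * γ + z * β) * α + ((1 + z) * γ + z * α) * β) ^ 2) := by positivity
    linarith

lemma key (z α β γ X Y T : ℝ) (hz0 : 0 < z) (hz1 : z < 1 / 2)
    (hX0 : 0 ≤ X) (hY0 : 0 ≤ Y) (hT0 : 0 ≤ T)
    (hN : α ^ 2 + β ^ 2 + γ ^ 2 + 2 * z * (α * β + β * γ + γ * α) = 1)
    (hX : X ^ 2 = (1 - z) * ((1 + z) * (β ^ 2 + γ ^ 2) + 2 * z * (β * γ)))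
    (hY : Y ^ 2 = (1 - z) * ((1 + z) * (γ ^ 2 + α ^ 2) + 2 * z * (γ * α)))
    (hT : T ^ 2 = (1 - z) * ((1 + z) * (α ^ 2 + β ^ 2) + 2 * z * (α * β))) :
    4 * (1 - z ^ 2) ≤ (X + Y + T) ^ 2 ∧
    ((X + Y + T) ^ 2 ≤ 4 * (1 - z ^ 2) → α * β = 0 ∧ β * γ = 0 ∧ γ * α = 0) := by
  obtain ⟨h1, h1'⟩ := prod_bound z α β γ X Y hz0 hX0 hY0 hX (by rw [hY]; ring)
  obtain ⟨h2, h2'⟩ := prod_bound z β γ α Y T hz0 hY0 hT0 hY (by rw [hT]; ring)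
  obtain ⟨h3, h3'⟩ := prod_bound z γ α β T X hz0 hT0 hX0 hT (by rw [hX]; ring)
  have hexp : (X + Y + T) ^ 2 = X ^ 2 + Y ^ 2 + T ^ 2 + 2 * (X * Y + Y * T + T * X) := by ring
  have hrhs : 4 * (1 - z ^ 2) = 4 * (1 - z ^ 2) *
    (α ^ 2 + β ^ 2 + γ ^ 2 + 2 * z * (α * β + β * γ + γ * α)) := by rw [hN, mul_one]
  set s := α * β + β * γ + γ * α with hs
  -- slack in the first bound
  have e1 : (X + Y + T) ^ 2 - 4 * (1 - z ^ 2) ≥ (1 - z) * (2 * (1 - 2 * z) * (1 + 2 * z)) * s := by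
    rw [hrhs, hexp, hX, hY, hT, hs]
    linarith [h1, h2, h3]
  have e2 : (1 + z) * ((X + Y + T) ^ 2 - 4 * (1 - z ^ 2)) ≥
      (1 - z) * (-(2 + 6 * z + 8 * z ^ 2 + 8 * z ^ 3)) * s := by
    rw [hrhs, hexp, hX, hY, hT, hs]
    linarith [h1', h2', h3']
  have c1 : 0 < (1 - z) * (2 * (1 - 2 * z) * (1 + 2 * z)) := by
    have : 0 < 1 - z := by linarith
    have : 0 < 1 - 2 * z := by linarith
    positivity
  have c2 : 0 < (1 - z) * (2 + 6 * z + 8 * z ^ 2 + 8 * z ^ 3) := by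
    have : 0 < 1 - z := by linarith
    positivity
  have hz2 : 0 < 1 - z := by linarith
  rcases lt_trichotomy s 0 with h | h | h
  · have : 0 < (1 - z) * (2 + 6 * z + 8 * z ^ 2 + 8 * z ^ 3) * (-s) :=
      mul_pos c2 (by linarith)
    have h4 : 0 < (1 + z) * ((X + Y + T) ^ 2 - 4 * (1 - z ^ 2)) := by linarith
    have h5 := (mul_pos_iff_of_pos_left (by linarith : 0 < 1 + z)).1 h4
    exact ⟨by linarith, fun h6 => by linarith⟩
  · rw [h, mul_zero] at e1
    refine ⟨by linarith, fun h6 => ?_⟩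
    rw [hrhs, hexp, hX, hY, hT] at h6
    have hs0 : (1 - z) * (2 * (1 - 2 * z) * (1 + 2 * z)) * s = 0 := by rw [h, mul_zero]
    rw [hs] at hs0 h6
    have k1 : X * Y ≤ (1 - z) * ((1 + z) * (γ ^ 2 + α * β) + z * (γ * (α + β))) := by linarith
    have k2 : Y * T ≤ (1 - z) * ((1 + z) * (α ^ 2 + β * γ) + z * (α * (β + γ))) := by linarith
    have k3 : T * X ≤ (1 - z) * ((1 + z) * (β ^ 2 + γ * α) + z * (β * (γ + α))) := by linarith
    have hz3 : 0 ≤ 1 + z := by linarith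
    have k1' := mul_le_mul_of_nonneg_left k1 hz3
    have k2' := mul_le_mul_of_nonneg_left k2 hz3
    have k3' := mul_le_mul_of_nonneg_left k3 hz3
    have hc : 0 < (1 - z) * (2 + 4 * z) := by positivity
    have p1 : 0 ≤ α * β := by
      refine (mul_nonneg_iff_of_pos_left hc).1 ?_
      linarith
    have p2 : 0 ≤ β * γ := by
      refine (mul_nonneg_iff_of_pos_left hc).1 ?_
      linarith
    have p3 : 0 ≤ γ * α := by
      refine (mul_nonneg_iff_of_pos_left hc).1 ?_
      linarith
    refine ⟨?_, ?_, ?_⟩ <;> linarith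
  · have := mul_pos c1 h
    exact ⟨by linarith, fun h6 => by linarith⟩

lemma eq_one_or_neg_one_of_sq {t : ℝ} (h : t ^ 2 = 1) : t = 1 ∨ t = -1 := by
  have : (t - 1) * (t + 1) = 0 := by linarith
  rcases mul_eq_zero.1 this with h | h
  · left; linarith
  · right; linarith

lemma J_neg (a b c p : EuclideanSpace ℝ (Fin 3)) : J a b c (-p) = J a b c p := by
  simp [J, dS]

lemma J_low (a b c : EuclideanSpace ℝ (Fin 3)) (z : ℝ)
    (ha : ‖a‖ = 1) (hb : ‖b‖ = 1) (hc : ‖c‖ = 1)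
    (hli : LinearIndependent ℝ ![a, b, c])
    (hab : ⟪a, b⟫ = z) (hac : ⟪a, c⟫ = z) (hbc : ⟪b, c⟫ = z)
    (hz0 : 0 < z) (hz1 : z < 1 / 2) (p : EuclideanSpace ℝ (Fin 3)) (hp : ‖p‖ = 1) :
    2 * Real.sqrt (1 - z ^ 2) ≤ J a b c p ∧ (J a b c p ≤ 2 * Real.sqrt (1 - z ^ 2) →
      p = a ∨ p = -a ∨ p = b ∨ p = -b ∨ p = c ∨ p = -c) := by
  obtain ⟨α, β, γ, rfl⟩ : ∃ α β γ : ℝ, p = α • a + β • b + γ • c := by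
    let B := basisOfLinearIndependentOfCardEqFinrank hli (by simp)
    have := B.sum_repr p
    rw [Fin.sum_univ_three] at this
    refine ⟨B.repr p 0, B.repr p 1, B.repr p 2, ?_⟩
    have h0 : B 0 = a := by simp [B]
    have h1 : B 1 = b := by simp [B]
    have h2 : B 2 = c := by simp [B]
    rw [h0, h1, h2] at this
    exact this.symm
  have haa : ⟪a, a⟫ = 1 := by rw [real_inner_self_eq_norm_sq, ha]; norm_num
  have hbb : ⟪b, b⟫ = 1 := by rw [real_inner_self_eq_norm_sq, hb]; norm_num
  have hcc : ⟪c, c⟫ = 1 := by rw [real_inner_self_eq_norm_sq, hc]; norm_num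
  have hba : ⟪b, a⟫ = z := by rw [real_inner_comm, hab]
  have hca : ⟪c, a⟫ = z := by rw [real_inner_comm, hac]
  have hcb : ⟪c, b⟫ = z := by rw [real_inner_comm, hbc]
  have hN : α ^ 2 + β ^ 2 + γ ^ 2 + 2 * z * (α * β + β * γ + γ * α) = 1 := by
    have h := real_inner_self_eq_norm_sq (α • a + β • b + γ • c)
    rw [hp] at h
    simp only [inner_add_left, inner_add_right, real_inner_smul_left, real_inner_smul_right,
      haa, hbb, hcc, hab, hac, hbc, hba, hca, hcb] at h
    linarith
  have hz2 : 0 < 1 - z := by linarith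
  have hS : Real.sqrt (1 - z ^ 2) ^ 2 = 1 - z ^ 2 := Real.sq_sqrt (by nlinarith)
  have hd : ∀ x : EuclideanSpace ℝ (Fin 3), ‖x‖ = 1 →
      dS x (α • a + β • b + γ • c) ^ 2 = 1 - ⟪x, α • a + β • b + γ • c⟫ ^ 2 := by
    intro x hx
    refine Real.sq_sqrt ?_
    have := abs_real_inner_le_norm x (α • a + β • b + γ • c)
    rw [hx, hp, one_mul] at this
    have := (sq_le_one_iff_abs_le_one _).2 this
    linarith
  obtain ⟨k1, k2⟩ := key z α β γ (dS a (α • a + β • b + γ • c)) (dS b (α • a + β • b + γ • c))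
    (dS c (α • a + β • b + γ • c)) hz0 hz1 (Real.sqrt_nonneg _) (Real.sqrt_nonneg _)
    (Real.sqrt_nonneg _) hN
    (by
      rw [hd a ha]
      simp only [inner_add_right, real_inner_smul_right, haa, hab, hac]
      linear_combination -hN)
    (by
      rw [hd b hb]
      simp only [inner_add_right, real_inner_smul_right, hbb, hba, hbc]
      linear_combination -hN)
    (by
      rw [hd c hc]
      simp only [inner_add_right, real_inner_smul_right, hcc, hca, hcb]
      linear_combination -hN)
  have hJ0 : 0 ≤ J a b c (α • a + β • b + γ • c) :=
    add_nonneg (add_nonneg (Real.sqrt_nonneg _) (Real.sqrt_nonneg _)) (Real.sqrt_nonneg _)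
  change _ ≤ J a b c (α • a + β • b + γ • c) ^ 2 at k1
  change J a b c (α • a + β • b + γ • c) ^ 2 ≤ _ → _ at k2
  constructor
  · apply (abs_le_of_sq_le_sq' _ hJ0).2
    rw [mul_pow, hS]
    linarith
  · intro hle
    have h6 := pow_le_pow_left₀ hJ0 hle 2
    rw [mul_pow, hS] at h6
    obtain ⟨q1, q2, q3⟩ := k2 (by linarith)
    rw [q1, q2, q3] at hN
    rcases mul_eq_zero.1 q1 with h | h
    · rcases mul_eq_zero.1 q2 with h' | h'
      · subst h; subst h'
        rcases eq_one_or_neg_one_of_sq (show γ ^ 2 = 1 by linarith) with h | h <;> subst h <;> simp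
      · subst h; subst h'
        rcases eq_one_or_neg_one_of_sq (show β ^ 2 = 1 by linarith) with h | h <;> subst h <;> simp
    · rcases mul_eq_zero.1 q3 with h' | h'
      · subst h; subst h'
        rcases eq_one_or_neg_one_of_sq (show α ^ 2 = 1 by linarith) with h | h <;> subst h <;> simp
      · subst h; subst h'
        rcases eq_one_or_neg_one_of_sq (show γ ^ 2 = 1 by linarith) with h | h <;> subst h <;> simp

theorem stmt2 (a b c : EuclideanSpace ℝ (Fin 3)) (z : ℝ)
    (ha : ‖a‖ = 1) (hb : ‖b‖ = 1) (hc : ‖c‖ = 1)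
    (hli : LinearIndependent ℝ ![a, b, c])
    (hab : ⟪a, b⟫ = z) (hac : ⟪a, c⟫ = z) (hbc : ⟪b, c⟫ = z)
    (hz0 : 0 < z) (hz1 : z < 1 / 2) :
    {p : EuclideanSpace ℝ (Fin 3) | IsMinimizer a b c p} = {a, -a, b, -b, c, -c} := by
  have hlow := J_low a b c z ha hb hc hli hab hac hbc hz0 hz1
  have hba : ⟪b, a⟫ = z := by rw [real_inner_comm, hab]
  have hca : ⟪c, a⟫ = z := by rw [real_inner_comm, hac]
  have hcb : ⟪c, b⟫ = z := by rw [real_inner_comm, hbc]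
  have Ja : J a b c a = 2 * Real.sqrt (1 - z ^ 2) := by
    simp only [J, dS, hba, hca, real_inner_self_eq_norm_sq, ha]
    norm_num; ring
  have Jb : J a b c b = 2 * Real.sqrt (1 - z ^ 2) := by
    simp only [J, dS, hab, hcb, real_inner_self_eq_norm_sq, hb]
    norm_num; ring
  have Jc : J a b c c = 2 * Real.sqrt (1 - z ^ 2) := by
    simp only [J, dS, hac, hbc, real_inner_self_eq_norm_sq, hc]
    norm_num; ring
  ext p
  simp only [Set.mem_setOf_eq, Set.mem_insert_iff, Set.mem_singleton_iff]
  constructor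
  · rintro ⟨hp, hmin⟩
    exact (hlow p hp).2 (Ja ▸ hmin a ha)
  · rintro (rfl | rfl | rfl | rfl | rfl | rfl)
    · exact ⟨ha, fun q hq => Ja ▸ (hlow q hq).1⟩
    · exact ⟨by rw [norm_neg, ha], fun q hq => by rw [J_neg, Ja]; exact (hlow q hq).1⟩
    · exact ⟨hb, fun q hq => Jb ▸ (hlow q hq).1⟩
    · exact ⟨by rw [norm_neg, hb], fun q hq => by rw [J_neg, Jb]; exact (hlow q hq).1⟩
    · exact ⟨hc, fun q hq => Jc ▸ (hlow q hq).1⟩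
    · exact ⟨by rw [norm_neg, hc], fun q hq => by rw [J_neg, Jc]; exact (hlow q hq).1⟩
end

section
/- Let a, b, c be linearly independent unit vectors in ℝ³ with ⟪a,b⟫ = ⟪a,c⟫ = ⟪b,c⟫ = 1/2 (an equilateral configuration with common angle exactly 60°), and let e = (a + b + c) / ‖a + b + c‖. Then the set of minimizers of J over the unit sphere is exactly {a, -a, b, -b, c, -c, e, -e}. -/
open RealInnerProductSpace

/-- Cauchy–Schwarz in the special form used below. -/
lemma aux_cs {A B C D u v : ℝ} (hu : 0 ≤ u) (hv : 0 ≤ v)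
    (hu2 : u ^ 2 = A ^ 2 / 2 + B ^ 2 / 4) (hv2 : v ^ 2 = C ^ 2 / 2 + D ^ 2 / 4) :
    A * C / 2 + B * D / 4 ≤ u * v := by
  refine (abs_le_of_sq_le_sq' ?_ (mul_nonneg hu hv)).2
  rw [mul_pow, hu2, hv2]
  nlinarith [sq_nonneg (A * D - B * C)]

lemma aux_cs_eq {A B C D u v : ℝ}
    (hu2 : u ^ 2 = A ^ 2 / 2 + B ^ 2 / 4) (hv2 : v ^ 2 = C ^ 2 / 2 + D ^ 2 / 4)
    (h : u * v = A * C / 2 + B * D / 4) : A * D = B * C := by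
  have h1 : (u * v) ^ 2 = (A * C / 2 + B * D / 4) ^ 2 := by rw [h]
  rw [mul_pow, hu2, hv2] at h1
  have : (A * D - B * C) ^ 2 = 0 := by nlinarith
  have := pow_eq_zero_iff (two_ne_zero) |>.1 this
  linarith

def Good (P Q R : ℝ) : Prop :=
  (P = Q ∧ R = 0) ∨ (P = R ∧ Q = 0) ∨ (Q = R ∧ P = 0) ∨ (P = Q ∧ Q = R)

lemma aux_core {P Q R u v w : ℝ} (hPQ : Q ≤ P) (hQR : R ≤ Q) (hR : 0 ≤ R)
    (hu : 0 ≤ u) (hv : 0 ≤ v) (hw : 0 ≤ w)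
    (hu2 : u ^ 2 = P ^ 2 / 2 + (Q - R) ^ 2 / 4)
    (hv2 : v ^ 2 = Q ^ 2 / 2 + (P - R) ^ 2 / 4)
    (hw2 : w ^ 2 = R ^ 2 / 2 + (P - Q) ^ 2 / 4) :
    3 / 2 * (P ^ 2 + Q ^ 2 + R ^ 2) ≤ (u + v + w) ^ 2 ∧
    ((u + v + w) ^ 2 ≤ 3 / 2 * (P ^ 2 + Q ^ 2 + R ^ 2) → Good P Q R) := by
  have h1 := aux_cs hu hv hu2 hv2
  have h2 := aux_cs hu hw hu2 hw2
  have h3 := aux_cs hv hw hv2 hw2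
  have h4 : 0 ≤ (P - Q) * (Q - R) := mul_nonneg (by linarith) (by linarith)
  refine ⟨by nlinarith, fun h => ?_⟩
  have e1 := aux_cs_eq hu2 hv2 (by nlinarith)
  have e2 := aux_cs_eq hu2 hw2 (by nlinarith)
  have e3 := aux_cs_eq hv2 hw2 (by nlinarith)
  have e4 : (P - Q) * (Q - R) = 0 := by nlinarith
  rcases mul_eq_zero.1 e4 with e | e
  · have hP : P = Q := by linarith
    subst hP
    have : R * (P - R) = 0 := by linarith
    rcases mul_eq_zero.1 this with h | h
    · exact Or.inl ⟨rfl, h⟩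
    · exact Or.inr (Or.inr (Or.inr ⟨rfl, by linarith⟩))
  · have hP : Q = R := by linarith
    subst hP
    have : P * (P - Q) = 0 := by linarith
    rcases mul_eq_zero.1 this with h | h
    · exact Or.inr (Or.inr (Or.inl ⟨rfl, h⟩))
    · exact Or.inr (Or.inr (Or.inr ⟨by linarith, rfl⟩))

lemma aux_nonneg {P Q R u v w : ℝ} (hP : 0 ≤ P) (hQ : 0 ≤ Q) (hR : 0 ≤ R)
    (hu : 0 ≤ u) (hv : 0 ≤ v) (hw : 0 ≤ w)
    (hu2 : u ^ 2 = P ^ 2 / 2 + (Q - R) ^ 2 / 4)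
    (hv2 : v ^ 2 = Q ^ 2 / 2 + (P - R) ^ 2 / 4)
    (hw2 : w ^ 2 = R ^ 2 / 2 + (P - Q) ^ 2 / 4) :
    3 / 2 * (P ^ 2 + Q ^ 2 + R ^ 2) ≤ (u + v + w) ^ 2 ∧
    ((u + v + w) ^ 2 ≤ 3 / 2 * (P ^ 2 + Q ^ 2 + R ^ 2) → Good P Q R) := by
  have key : ∀ {P' Q' R' u' v' w' : ℝ}, 
      (3 / 2 * (P' ^ 2 + Q' ^ 2 + R' ^ 2) ≤ (u' + v' + w') ^ 2 ∧
      ((u' + v' + w') ^ 2 ≤ 3 / 2 * (P' ^ 2 + Q' ^ 2 + R' ^ 2) → Good P' Q' R')) →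
      P' ^ 2 + Q' ^ 2 + R' ^ 2 = P ^ 2 + Q ^ 2 + R ^ 2 → u' + v' + w' = u + v + w →
      (Good P' Q' R' → Good P Q R) → 
      3 / 2 * (P ^ 2 + Q ^ 2 + R ^ 2) ≤ (u + v + w) ^ 2 ∧
      ((u + v + w) ^ 2 ≤ 3 / 2 * (P ^ 2 + Q ^ 2 + R ^ 2) → Good P Q R) := by
    intro P' Q' R' u' v' w' h1 h2 h3 h4
    rw [h2, h3] at h1
    exact ⟨h1.1, fun h => h4 (h1.2 h)⟩
  rcases le_total P Q with h1 | h1 <;> rcases le_total Q R with h2 | h2 <;>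
    rcases le_total P R with h3 | h3
  · exact key (aux_core h2 h1 hP hw hv hu (by linarith) (by linarith) (by linarith))
      (by ring) (by ring) (by unfold Good; grind)
  · exact key (aux_core h2 h1 hP hw hv hu (by linarith) (by linarith) (by linarith))
      (by ring) (by ring) (by unfold Good; grind)
  · exact key (aux_core h2 h3 hP hv hw hu (by linarith) (by linarith) (by linarith))
      (by ring) (by ring) (by unfold Good; grind)
  · exact key (aux_core h1 h3 hR hv hu hw (by linarith) (by linarith) (by linarith))
      (by ring) (by ring) (by unfold Good; grind)
  · exact key (aux_core h3 h1 hQ hw hu hv (by linarith) (by linarith) (by linarith))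
      (by ring) (by ring) (by unfold Good; grind)
  · exact key (aux_core h3 h2 hQ hu hw hv (by linarith) (by linarith) (by linarith))
      (by ring) (by ring) (by unfold Good; grind)
  · exact aux_core h1 h2 hR hu hv hw hu2 hv2 hw2
  · exact aux_core h1 h2 hR hu hv hw hu2 hv2 hw2

lemma aux_abs_sub (Q R : ℝ) : (|Q| - |R|) ^ 2 ≤ (Q - R) ^ 2 := by
  have := le_abs_self (Q * R)
  rw [abs_mul] at this
  nlinarith [sq_abs Q, sq_abs R]

lemma aux_abs_eq {Q R : ℝ} (h : (Q - R) ^ 2 = (|Q| - |R|) ^ 2) : |Q| * |R| = Q * R := by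
  nlinarith [sq_abs Q, sq_abs R]

lemma aux_sign {P Q : ℝ} (h : |P| = |Q|) (h2 : |P| * |Q| = P * Q) : P = Q := by
  rcases abs_eq_abs.1 h with h | h
  · exact h
  · subst h
    have : Q ^ 2 = 0 := by
      rw [abs_neg] at h2
      nlinarith [sq_abs Q]
    have := pow_eq_zero_iff (two_ne_zero) |>.1 this
    simp [this]

lemma aux_all {P Q R u v w : ℝ}
    (hu : 0 ≤ u) (hv : 0 ≤ v) (hw : 0 ≤ w)
    (hu2 : u ^ 2 = P ^ 2 / 2 + (Q - R) ^ 2 / 4)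
    (hv2 : v ^ 2 = Q ^ 2 / 2 + (P - R) ^ 2 / 4)
    (hw2 : w ^ 2 = R ^ 2 / 2 + (P - Q) ^ 2 / 4) :
    3 / 2 * (P ^ 2 + Q ^ 2 + R ^ 2) ≤ (u + v + w) ^ 2 ∧
    ((u + v + w) ^ 2 ≤ 3 / 2 * (P ^ 2 + Q ^ 2 + R ^ 2) → Good P Q R) := by
  obtain ⟨u', hu', hu2'⟩ : ∃ u', 0 ≤ u' ∧ u' ^ 2 = |P| ^ 2 / 2 + (|Q| - |R|) ^ 2 / 4 :=
    ⟨_, Real.sqrt_nonneg _, Real.sq_sqrt (by positivity)⟩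
  obtain ⟨v', hv', hv2'⟩ : ∃ u', 0 ≤ u' ∧ u' ^ 2 = |Q| ^ 2 / 2 + (|P| - |R|) ^ 2 / 4 :=
    ⟨_, Real.sqrt_nonneg _, Real.sq_sqrt (by positivity)⟩
  obtain ⟨w', hw', hw2'⟩ : ∃ u', 0 ≤ u' ∧ u' ^ 2 = |R| ^ 2 / 2 + (|P| - |Q|) ^ 2 / 4 :=
    ⟨_, Real.sqrt_nonneg _, Real.sq_sqrt (by positivity)⟩
  obtain ⟨k1, k2⟩ := aux_nonneg (abs_nonneg P) (abs_nonneg Q) (abs_nonneg R)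
    hu' hv' hw' hu2' hv2' hw2'
  simp only [sq_abs] at k1 k2 hu2' hv2' hw2'
  have lu : u' ≤ u := abs_le_of_sq_le_sq' (by linarith [aux_abs_sub Q R]) hu |>.2
  have lv : v' ≤ v := abs_le_of_sq_le_sq' (by linarith [aux_abs_sub P R]) hv |>.2
  have lw : w' ≤ w := abs_le_of_sq_le_sq' (by linarith [aux_abs_sub P Q]) hw |>.2
  have ls : (u' + v' + w') ^ 2 ≤ (u + v + w) ^ 2 := by gcongr
  refine ⟨k1.trans ls, fun h => ?_⟩
  have g := k2 (ls.trans h)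
  have hs : u + v + w ≤ u' + v' + w' :=
    abs_le_of_sq_le_sq' (h.trans k1) (by positivity) |>.2
  have eu : u' = u := by linarith
  have ev : v' = v := by linarith
  have ew : w' = w := by linarith
  subst eu ev ew
  have a1 : |Q| * |R| = Q * R := aux_abs_eq (by linarith)
  have a2 : |P| * |R| = P * R := aux_abs_eq (by linarith)
  have a3 : |P| * |Q| = P * Q := aux_abs_eq (by linarith)
  rcases g with ⟨g1, g2⟩ | ⟨g1, g2⟩ | ⟨g1, g2⟩ | ⟨g1, g2⟩
  · exact Or.inl ⟨aux_sign g1 a3, abs_eq_zero.1 g2⟩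
  · exact Or.inr (Or.inl ⟨aux_sign g1 a2, abs_eq_zero.1 g2⟩)
  · exact Or.inr (Or.inr (Or.inl ⟨aux_sign g1 a1, abs_eq_zero.1 g2⟩))
  · exact Or.inr (Or.inr (Or.inr ⟨aux_sign g1 a3, aux_sign g2 a1⟩))

set_option maxHeartbeats 2000000 in
theorem stmt3 (a b c : EuclideanSpace ℝ (Fin 3))
    (ha : ‖a‖ = 1) (hb : ‖b‖ = 1) (hc : ‖c‖ = 1)
    (hli : LinearIndependent ℝ ![a, b, c])
    (hab : ⟪a, b⟫ = 1 / 2) (hac : ⟪a, c⟫ = 1 / 2) (hbc : ⟪b, c⟫ = 1 / 2)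
    (e : EuclideanSpace ℝ (Fin 3)) (he : e = ‖a + b + c‖⁻¹ • (a + b + c)) :
    {p : EuclideanSpace ℝ (Fin 3) | IsMinimizer a b c p} = {a, -a, b, -b, c, -c, e, -e} := by
  have haa : ⟪a, a⟫ = 1 := by rw [real_inner_self_eq_norm_sq, ha]; norm_num
  have hbb : ⟪b, b⟫ = 1 := by rw [real_inner_self_eq_norm_sq, hb]; norm_num
  have hcc : ⟪c, c⟫ = 1 := by rw [real_inner_self_eq_norm_sq, hc]; norm_num
  have hba : ⟪b, a⟫ = 1 / 2 := by rw [real_inner_comm, hab]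
  have hca : ⟪c, a⟫ = 1 / 2 := by rw [real_inner_comm, hac]
  have hcb : ⟪c, b⟫ = 1 / 2 := by rw [real_inner_comm, hbc]
  have hspan : Submodule.span ℝ (Set.range ![a, b, c]) = ⊤ :=
    hli.span_eq_top_of_card_eq_finrank (by simp)
  have hzero : ∀ q : EuclideanSpace ℝ (Fin 3), ⟪a, q⟫ = 0 → ⟪b, q⟫ = 0 → ⟪c, q⟫ = 0 → q = 0 := by
    intro q h1 h2 h3
    have hall : ∀ r ∈ Submodule.span ℝ (Set.range ![a, b, c]), ⟪r, q⟫ = 0 := by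
      intro r hr
      induction hr using Submodule.span_induction with
      | mem x hx =>
        obtain ⟨i, rfl⟩ := hx
        fin_cases i <;> simp [h1, h2, h3]
      | zero => simp
      | add x y _ _ hx hy => rw [inner_add_left, hx, hy, add_zero]
      | smul t x _ hx => rw [real_inner_smul_left, hx, mul_zero]
    exact inner_self_eq_zero.1 (hall q (by rw [hspan]; trivial))
  have hexp : ∀ p : EuclideanSpace ℝ (Fin 3), p =
      ((3 * ⟪a, p⟫ - ⟪b, p⟫ - ⟪c, p⟫) / 2) • a + ((3 * ⟪b, p⟫ - ⟪a, p⟫ - ⟪c, p⟫) / 2) • b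
        + ((3 * ⟪c, p⟫ - ⟪a, p⟫ - ⟪b, p⟫) / 2) • c := by
    intro p
    rw [← sub_eq_zero]
    apply hzero <;>
    simp only [inner_sub_right, inner_add_right, real_inner_smul_right, haa, hbb, hcc, hab, hac,
      hbc, hba, hca, hcb] <;> ring
  have hcon : ∀ p : EuclideanSpace ℝ (Fin 3), ‖p‖ = 1 →
      3 * (⟪a, p⟫ ^ 2 + ⟪b, p⟫ ^ 2 + ⟪c, p⟫ ^ 2)
        - 2 * (⟪a, p⟫ * ⟪b, p⟫ + ⟪a, p⟫ * ⟪c, p⟫ + ⟪b, p⟫ * ⟪c, p⟫) = 2 := by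
    intro p hp
    have h1 : ⟪p, p⟫ = 1 := by rw [real_inner_self_eq_norm_sq, hp]; norm_num
    nth_rw 1 [hexp p] at h1
    simp only [inner_add_left, real_inner_smul_left] at h1
    linarith
  have hmain : ∀ p : EuclideanSpace ℝ (Fin 3), ‖p‖ = 1 → 3 ≤ J a b c p ^ 2 ∧
      (J a b c p ^ 2 ≤ 3 → Good (⟪b, p⟫ + ⟪c, p⟫ - ⟪a, p⟫) (⟪a, p⟫ + ⟪c, p⟫ - ⟪b, p⟫)
        (⟪a, p⟫ + ⟪b, p⟫ - ⟪c, p⟫)) := by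
    intro p hp
    have h := hcon p hp
    have sq : ∀ x : EuclideanSpace ℝ (Fin 3), ‖x‖ = 1 → dS x p ^ 2 = 1 - ⟪x, p⟫ ^ 2 := by
      intro x hx
      apply Real.sq_sqrt
      have := abs_real_inner_le_norm x p
      rw [hx, hp, one_mul] at this
      have := (sq_le_one_iff_abs_le_one _).2 this
      linarith
    have := aux_all (P := ⟪b, p⟫ + ⟪c, p⟫ - ⟪a, p⟫) (Q := ⟪a, p⟫ + ⟪c, p⟫ - ⟪b, p⟫)
      (R := ⟪a, p⟫ + ⟪b, p⟫ - ⟪c, p⟫) (u := dS a p) (v := dS b p) (w := dS c p)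
      (Real.sqrt_nonneg _) (Real.sqrt_nonneg _) (Real.sqrt_nonneg _)
      (by rw [sq a ha]; linarith) (by rw [sq b hb]; linarith) (by rw [sq c hc]; linarith)
    have h3 : 3 / 2 * ((⟪b, p⟫ + ⟪c, p⟫ - ⟪a, p⟫) ^ 2 + (⟪a, p⟫ + ⟪c, p⟫ - ⟪b, p⟫) ^ 2 +
      (⟪a, p⟫ + ⟪b, p⟫ - ⟪c, p⟫) ^ 2) = 3 := by linarith
    rw [h3] at this
    exact this
  have hJ0 : ∀ p, 0 ≤ J a b c p := fun p =>
    add_nonneg (add_nonneg (Real.sqrt_nonneg _) (Real.sqrt_nonneg _)) (Real.sqrt_nonneg _)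
  have hJneg : ∀ p, J a b c (-p) = J a b c p := by
    intro p; simp [J, dS, inner_neg_right]
  have s34 : √(1 - (1 / 2 : ℝ) ^ 2) ^ 2 = 3 / 4 := by
    rw [Real.sq_sqrt (by norm_num)]; norm_num
  have s0 : √(1 - (1 : ℝ) ^ 2) = 0 := by norm_num
  have hJa : J a b c a ^ 2 = 3 := by
    simp only [J, dS, haa, hba, hca, s0]; linarith
  have hJb : J a b c b ^ 2 = 3 := by
    simp only [J, dS, hbb, hab, hcb, s0]; linarith
  have hJc : J a b c c ^ 2 = 3 := by
    simp only [J, dS, hcc, hac, hbc, s0]; linarith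
  have hn2 : ‖a + b + c‖ ^ 2 = 6 := by
    rw [← real_inner_self_eq_norm_sq]
    simp only [inner_add_left, inner_add_right, haa, hbb, hcc, hab, hac, hbc, hba, hca, hcb]
    norm_num
  have hn0 : ‖a + b + c‖ ≠ 0 := by
    intro h; rw [h] at hn2; norm_num at hn2
  have hne : ‖e‖ = 1 := by
    rw [he, norm_smul, norm_inv, norm_norm, inv_mul_cancel₀ hn0]
  have hJe : J a b c e ^ 2 = 3 := by
    have h1 : ∀ x : EuclideanSpace ℝ (Fin 3), ⟪x, a⟫ + ⟪x, b⟫ + ⟪x, c⟫ = 2 →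
        dS x e = √(1 / 3) := by
      intro x hx
      rw [dS, he, real_inner_smul_right, inner_add_right, inner_add_right, hx, mul_pow, inv_pow, hn2]
      norm_num
    rw [J, h1 a (by linarith), h1 b (by linarith), h1 c (by linarith)]
    have : √(1 / 3 : ℝ) ^ 2 = 1 / 3 := Real.sq_sqrt (by norm_num)
    linarith
  have hmin : ∀ p, IsMinimizer a b c p ↔ ‖p‖ = 1 ∧ J a b c p ^ 2 ≤ 3 := by
    intro p
    constructor
    · rintro ⟨h1, h2⟩
      refine ⟨h1, ?_⟩
      rw [← hJa]
      exact pow_le_pow_left₀ (hJ0 p) (h2 a ha) 2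
    · rintro ⟨h1, h2⟩
      exact ⟨h1, fun q hq => abs_le_of_sq_le_sq' (h2.trans (hmain q hq).1) (hJ0 q) |>.2⟩
  ext p
  simp only [Set.mem_ofPred_eq, Set.mem_insert_iff, Set.mem_singleton_iff, hmin]
  constructor
  · rintro ⟨hp, hJ⟩
    have hg := (hmain p hp).2 hJ
    have hx := hexp p
    have hq := hcon p hp
    generalize ⟪a, p⟫ = x at *
    generalize ⟪b, p⟫ = y at *
    generalize ⟪c, p⟫ = z at *
    rcases hg with ⟨g1, g2⟩ | ⟨g1, g2⟩ | ⟨g1, g2⟩ | ⟨g1, g2⟩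
    · obtain rfl : x = y := by linarith
      obtain rfl : z = 2 * x := by linarith
      have : (2 * x - 1) * (2 * x + 1) = 0 := by nlinarith
      rcases mul_eq_zero.1 this with h | h
      · obtain rfl : x = 1 / 2 := by linarith
        have : p = c := by rw [hx]; norm_num
        simp [this]
      · obtain rfl : x = -1 / 2 := by linarith
        have : p = -c := by rw [hx]; norm_num
        simp [this]
    · obtain rfl : x = z := by linarith
      obtain rfl : y = 2 * x := by linarith
      have : (2 * x - 1) * (2 * x + 1) = 0 := by nlinarith
      rcases mul_eq_zero.1 this with h | h
      · obtain rfl : x = 1 / 2 := by linarith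
        have : p = b := by rw [hx]; norm_num
        simp [this]
      · obtain rfl : x = -1 / 2 := by linarith
        have : p = -b := by rw [hx]; norm_num
        simp [this]
    · obtain rfl : y = z := by linarith
      obtain rfl : x = 2 * y := by linarith
      have : (2 * y - 1) * (2 * y + 1) = 0 := by nlinarith
      rcases mul_eq_zero.1 this with h | h
      · obtain rfl : y = 1 / 2 := by linarith
        have : p = a := by rw [hx]; norm_num
        simp [this]
      · obtain rfl : y = -1 / 2 := by linarith
        have : p = -a := by rw [hx]; norm_num
        simp [this]
    · obtain rfl : x = y := by linarith
      obtain rfl : x = z := by linarith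
      have hx' : p = (x / 2) • (a + b + c) := by
        rw [hx, smul_add, smul_add]; congr <;> ring
      have h3 : (‖a + b + c‖ * (x / 2)) ^ 2 = 1 := by
        rw [mul_pow, hn2]; nlinarith
      rcases (sq_eq_sq_iff_eq_or_eq_neg.1 (by rw [h3]; norm_num) : ‖a + b + c‖ * (x / 2) = 1 ∨ ‖a + b + c‖ * (x / 2) = -1) with h | h
      · have h5 : x / 2 = ‖a + b + c‖⁻¹ := eq_inv_of_mul_eq_one_right h
        have : p = e := by rw [hx', h5, he]
        simp [this]
      · have h5 : -(x / 2) = ‖a + b + c‖⁻¹ := eq_inv_of_mul_eq_one_right (by linarith)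
        have : p = -e := by rw [hx', he, ← h5, neg_smul, neg_neg]
        simp [this]
  · rintro (rfl | rfl | rfl | rfl | rfl | rfl | rfl | rfl) <;>
      simp only [hJneg, norm_neg, ha, hb, hc, hne, hJa, hJb, hJc, hJe, le_refl, and_self]
end

section
/- For any unit vectors v₁, v₂, v₃ in ℝ³ one has d(v₁, v₂) ≤ d(v₁, v₃) + d(v₂, v₃), and equality holds if and only if v₃ = v₁ or v₃ = -v₁ or v₃ = v₂ or v₃ = -v₂. -/
open RealInnerProductSpace

theorem aux_real (a b c s t : ℝ) (hs : 0 ≤ s) (ht : 0 ≤ t) (hs2 : s ^ 2 = 1 - a ^ 2)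
    (ht2 : t ^ 2 = 1 - b ^ 2) (hc : (c - a * b) ^ 2 ≤ (s * t) ^ 2) :
    1 - c ^ 2 ≤ (s + t) ^ 2 ∧ (1 - c ^ 2 = (s + t) ^ 2 → s = 0 ∨ t = 0) := by
  have hst : 0 ≤ s * t := mul_nonneg hs ht
  have hA0 := abs_nonneg a
  have hB0 := abs_nonneg b
  have hA2 : |a| ^ 2 = 1 - s ^ 2 := by rw [sq_abs]; linarith
  have hB2 : |b| ^ 2 = 1 - t ^ 2 := by rw [sq_abs]; linarith
  have hA1 : |a| ≤ 1 := by nlinarith [sq_nonneg s]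
  have hB1 : |b| ≤ 1 := by nlinarith [sq_nonneg t]
  have h1 : |c - a * b| ≤ s * t := abs_le_of_sq_le_sq hc hst
  have h2 : |a| * |b| - s * t ≤ |c| := by
    have h := abs_sub_abs_le_abs_sub (a * b) c
    rw [abs_sub_comm, abs_mul] at h
    linarith
  rw [← sq_abs c]
  generalize |a| = A at *
  generalize |b| = B at *
  generalize |c| = C at *
  rcases le_total (s * t) (A * B) with h | h
  · have h3 : (A * B - s * t) ^ 2 ≤ C ^ 2 := pow_le_pow_left₀ (by linarith) h2 2
    have h4 : 1 - (A * B - s * t) ^ 2 = (s * B + A * t) ^ 2 := by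
      linear_combination (-B ^ 2 - t ^ 2) * hA2 - hB2
    have e1 : s * B ≤ s := mul_le_of_le_one_right hs hB1
    have e2 : A * t ≤ t := mul_le_of_le_one_left ht hA1
    have e3 : 0 ≤ s * B := by positivity
    have e4 : 0 ≤ A * t := by positivity
    refine ⟨by nlinarith, fun he => ?_⟩
    have h5 : s + t ≤ s * B + A * t := by
      refine (pow_le_pow_iff_left₀ (by positivity) (by linarith) two_ne_zero).mp ?_
      linarith
    have h6 : s * (1 - B) = 0 := by linarith
    rcases mul_eq_zero.mp h6 with h7 | h7
    · exact Or.inl h7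
    · right
      have : B = 1 := by linarith
      subst this
      nlinarith
  · have h3 : (A * B) ^ 2 ≤ (s * t) ^ 2 := pow_le_pow_left₀ (by positivity) h 2
    have h4 : (A * B) ^ 2 - (s * t) ^ 2 = 1 - s ^ 2 - t ^ 2 := by
      linear_combination B ^ 2 * hA2 + (1 - s ^ 2) * hB2
    refine ⟨by nlinarith [sq_nonneg C], fun he => ?_⟩
    apply mul_eq_zero.mp
    nlinarith [sq_nonneg C]

theorem aux_le {x y : EuclideanSpace ℝ (Fin 3)} (hx : ‖x‖ = 1) (hy : ‖y‖ = 1) :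
    0 ≤ 1 - ⟪x, y⟫ ^ 2 := by
  have h := abs_real_inner_le_norm x y
  rw [hx, hy, mul_one] at h
  have := (sq_le_one_iff_abs_le_one _).mpr h
  linarith

theorem aux_zero {x y : EuclideanSpace ℝ (Fin 3)} (hx : ‖x‖ = 1) (hy : ‖y‖ = 1)
    (h : dS x y = 0) : y = x ∨ y = -x := by
  have h0 := (Real.sqrt_eq_zero (aux_le hx hy)).mp h
  have h1 : (⟪x, y⟫ - 1) * (⟪x, y⟫ + 1) = 0 := by linarith
  rcases mul_eq_zero.mp h1 with h2 | h2
  · left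
    have h3 : ⟪x, y⟫ = 1 := by linarith
    exact ((inner_eq_one_iff_of_norm_eq_one hx hy).mp h3).symm
  · right
    have h3 : ⟪-x, y⟫ = 1 := by rw [inner_neg_left]; linarith
    exact ((inner_eq_one_iff_of_norm_eq_one (by rwa [norm_neg]) hy).mp h3).symm

theorem aux_comm (x y : EuclideanSpace ℝ (Fin 3)) : dS x y = dS y x := by
  unfold dS; rw [real_inner_comm]

theorem aux_neg (x y : EuclideanSpace ℝ (Fin 3)) : dS x (-y) = dS x y := by
  unfold dS; rw [inner_neg_right, neg_sq]

theorem aux_self {x : EuclideanSpace ℝ (Fin 3)} (hx : ‖x‖ = 1) : dS x x = 0 := by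
  unfold dS; rw [real_inner_self_eq_norm_sq, hx]; simp

theorem stmt5 (v₁ v₂ v₃ : EuclideanSpace ℝ (Fin 3))
    (h1 : ‖v₁‖ = 1) (h2 : ‖v₂‖ = 1) (h3 : ‖v₃‖ = 1) :
    dS v₁ v₂ ≤ dS v₁ v₃ + dS v₂ v₃ ∧
    (dS v₁ v₂ = dS v₁ v₃ + dS v₂ v₃ ↔ v₃ = v₁ ∨ v₃ = -v₁ ∨ v₃ = v₂ ∨ v₃ = -v₂) := by
  have hs : 0 ≤ dS v₁ v₃ := Real.sqrt_nonneg _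
  have ht : 0 ≤ dS v₂ v₃ := Real.sqrt_nonneg _
  have hs2 : dS v₁ v₃ ^ 2 = 1 - ⟪v₁, v₃⟫ ^ 2 := Real.sq_sqrt (aux_le h1 h3)
  have ht2 : dS v₂ v₃ ^ 2 = 1 - ⟪v₂, v₃⟫ ^ 2 := Real.sq_sqrt (aux_le h2 h3)
  have hu2 : dS v₁ v₂ ^ 2 = 1 - ⟪v₁, v₂⟫ ^ 2 := Real.sq_sqrt (aux_le h1 h2)
  have hc : (⟪v₁, v₂⟫ - ⟪v₁, v₃⟫ * ⟪v₂, v₃⟫) ^ 2 ≤ (dS v₁ v₃ * dS v₂ v₃) ^ 2 := by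
    have h := real_inner_mul_inner_self_le (v₁ - ⟪v₁, v₃⟫ • v₃) (v₂ - ⟪v₂, v₃⟫ • v₃)
    simp only [inner_sub_left, inner_sub_right, real_inner_smul_left, real_inner_smul_right,
      real_inner_self_eq_norm_sq, h1, h2, h3, real_inner_comm v₁ v₃, real_inner_comm v₂ v₃] at h
    rw [mul_pow, hs2, ht2]
    simp only [norm_smul, h3, Real.norm_eq_abs, mul_one, sq_abs] at h
    ring_nf at h ⊢
    linarith
  obtain ⟨k1, k2⟩ := aux_real _ _ _ _ _ hs ht hs2 ht2 hc
  rw [← hu2] at k1 k2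
  refine ⟨(pow_le_pow_iff_left₀ (Real.sqrt_nonneg _) (by linarith) two_ne_zero).mp k1, fun he => ?_, ?_⟩
  · rcases k2 (by rw [he]) with h | h
    · rcases aux_zero h1 h3 h with h | h <;> simp [h]
    · rcases aux_zero h2 h3 h with h | h <;> simp [h]
  · rintro (h | h | h | h) <;> rw [h] <;>
      simp [aux_neg, aux_self h1, aux_self h2, aux_comm v₂ v₁]
end

section
/- Let a, b, c be linearly independent unit vectors in ℝ³ and let p be a unit vector that is a minimizer for (a,b,c). Let {v₁, v₂, v₃} = {a, b, c} (any ordering of the three vectors) and let n be a nonzero vector in ℝ³ with ⟪n, v₁⟫ = 0 and ⟪n, v₂⟫ = 0 (a normal vector to the plane spanned by v₁ and v₂). Then ⟪v₃, p⟫ and ⟪v₃, n⟫ · ⟪p, n⟫ are both nonnegative or both nonpositive; equivalently, ⟪v₃, p⟫ · ⟪v₃, n⟫ · ⟪p, n⟫ ≥ 0. -/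
open RealInnerProductSpace

theorem stmt8 (a b c p : EuclideanSpace ℝ (Fin 3))
    (ha : ‖a‖ = 1) (hb : ‖b‖ = 1) (hc : ‖c‖ = 1)
    (hli : LinearIndependent ℝ ![a, b, c])
    (hp : IsMinimizer a b c p)
    (v₁ v₂ v₃ n : EuclideanSpace ℝ (Fin 3))
    (hperm : ({v₁, v₂, v₃} : Set (EuclideanSpace ℝ (Fin 3))) = {a, b, c})
    (hn : n ≠ 0) (hn1 : ⟪n, v₁⟫ = 0) (hn2 : ⟪n, v₂⟫ = 0) :
    (0 ≤ ⟪v₃, p⟫ ∧ 0 ≤ ⟪v₃, n⟫ * ⟪p, n⟫) ∨ (⟪v₃, p⟫ ≤ 0 ∧ ⟪v₃, n⟫ * ⟪p, n⟫ ≤ 0) := by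
  obtain ⟨hp1, hmin⟩ := hp
  have hab : a ≠ b := fun h => by
    have := hli.injective (a₁ := 0) (a₂ := 1) (by simpa using h)
    simp at this
  have hac : a ≠ c := fun h => by
    have := hli.injective (a₁ := 0) (a₂ := 2) (by simpa using h)
    simp at this
  have hbc : b ≠ c := fun h => by
    have := hli.injective (a₁ := 1) (a₂ := 2) (by simpa using h)
    simp at this
  have h1 : v₁ = a ∨ v₁ = b ∨ v₁ = c := by
    have : v₁ ∈ ({a, b, c} : Set (EuclideanSpace ℝ (Fin 3))) := by rw [← hperm]; simp
    simpa using this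
  have h2 : v₂ = a ∨ v₂ = b ∨ v₂ = c := by
    have : v₂ ∈ ({a, b, c} : Set (EuclideanSpace ℝ (Fin 3))) := by rw [← hperm]; simp
    simpa using this
  have h3 : v₃ = a ∨ v₃ = b ∨ v₃ = c := by
    have : v₃ ∈ ({a, b, c} : Set (EuclideanSpace ℝ (Fin 3))) := by rw [← hperm]; simp
    simpa using this
  have ka : a = v₁ ∨ a = v₂ ∨ a = v₃ := by
    have : a ∈ ({v₁, v₂, v₃} : Set (EuclideanSpace ℝ (Fin 3))) := by rw [hperm]; simp
    simpa using this
  have kb : b = v₁ ∨ b = v₂ ∨ b = v₃ := by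
    have : b ∈ ({v₁, v₂, v₃} : Set (EuclideanSpace ℝ (Fin 3))) := by rw [hperm]; simp
    simpa using this
  have kc : c = v₁ ∨ c = v₂ ∨ c = v₃ := by
    have : c ∈ ({v₁, v₂, v₃} : Set (EuclideanSpace ℝ (Fin 3))) := by rw [hperm]; simp
    simpa using this
  clear hperm hli
  have hv3 : ‖v₃‖ = 1 := by
    rcases h3 with h | h | h <;> rw [h] <;> assumption
  have hJ : ∀ q, J a b c q = dS v₁ q + dS v₂ q + dS v₃ q := by
    intro q
    unfold J
    rcases ka with ka | ka | ka <;> rcases kb with kb | kb | kb <;>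
      rcases kc with kc | kc | kc <;>
      first
      | exact absurd (ka.trans kb.symm) hab
      | exact absurd (ka.trans kc.symm) hac
      | exact absurd (kb.trans kc.symm) hbc
      | (simp only [ka, kb, kc]; done)
      | (simp only [ka, kb, kc]; ring)
  have hN : 0 < ⟪n, n⟫ := real_inner_self_pos.mpr hn
  -- the reflection of `p` in the plane orthogonal to `n`
  obtain ⟨k, hk⟩ : ∃ k : ℝ, k * ⟪n, n⟫ = 2 * ⟪p, n⟫ :=
    ⟨2 * ⟪p, n⟫ / ⟪n, n⟫, by field_simp⟩
  have hq : ‖p - k • n‖ = 1 := by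
    have hpp : ⟪p, p⟫ = 1 := by rw [real_inner_self_eq_norm_sq, hp1]; norm_num
    have : ⟪p - k • n, p - k • n⟫ = 1 := by
      simp only [inner_sub_left, inner_sub_right, real_inner_smul_left, real_inner_smul_right,
        real_inner_comm p n] at *
      linear_combination hpp + k * hk
    rw [real_inner_self_eq_norm_sq] at this
    nlinarith [norm_nonneg (p - k • n)]
  have hm := hmin _ hq
  rw [hJ, hJ] at hm
  have e1 : dS v₁ (p - k • n) = dS v₁ p := by
    unfold dS
    rw [inner_sub_right, real_inner_smul_right, real_inner_comm n v₁, hn1]; simp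
  have e2 : dS v₂ (p - k • n) = dS v₂ p := by
    unfold dS
    rw [inner_sub_right, real_inner_smul_right, real_inner_comm n v₂, hn2]; simp
  rw [e1, e2] at hm
  have hm3 : dS v₃ p ≤ dS v₃ (p - k • n) := by linarith
  unfold dS at hm3
  have hcs : |⟪v₃, p - k • n⟫| ≤ 1 := by
    have := abs_real_inner_le_norm v₃ (p - k • n)
    rwa [hv3, hq, mul_one] at this
  have hcs2 : ⟪v₃, p - k • n⟫ ^ 2 ≤ 1 := (sq_le_one_iff_abs_le_one _).mpr hcs
  rw [Real.sqrt_le_sqrt_iff (by linarith)] at hm3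
  rw [inner_sub_right, real_inner_smul_right] at hm3
  generalize ⟪v₃, p⟫ = s at *
  generalize ⟪v₃, n⟫ = t at *
  generalize ⟪p, n⟫ = r at *
  generalize ⟪n, n⟫ = N at *
  have h4 : 0 ≤ s * (k * t) := by nlinarith [sq_nonneg (k * t)]
  have h5 : 0 ≤ s * (t * r) := by
    have : s * (t * r) = s * (k * t) * N / 2 := by linear_combination (-s * t / 2) * hk
    rw [this]; positivity
  exact mul_nonneg_iff.mp h5
end

section
/- Let a, b, c be linearly independent unit vectors in ℝ³ with ⟪a,b⟫ > 0, ⟪a,c⟫ > 0 and ⟪b,c⟫ > 0, and let p be a unit vector that is a minimizer for (a,b,c). Then either ⟪a,p⟫ ≥ 0, ⟪b,p⟫ ≥ 0 and ⟪c,p⟫ ≥ 0, or ⟪a,p⟫ ≤ 0, ⟪b,p⟫ ≤ 0 and ⟪c,p⟫ ≤ 0. -/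
open RealInnerProductSpace

/-- Abbreviation for the ambient space. -/
abbrev E3 := EuclideanSpace ℝ (Fin 3)

/-- A vector of norm less than one with larger inner products yields a better point. -/
theorem improve (a b c p v : E3) (hc : ‖c‖ = 1)
    (hp : IsMinimizer a b c p)
    (h1 : |⟪a, p⟫| ≤ ⟪a, v⟫) (h2 : |⟪b, p⟫| ≤ ⟪b, v⟫) (h3 : |⟪c, p⟫| ≤ ⟪c, v⟫)
    (hc0 : ⟪c, p⟫ < 0) (hv : ⟪v, v⟫ < 1) : False := by
  have hpos : 0 < |⟪c, p⟫| := abs_pos.mpr hc0.ne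
  have hv0 : v ≠ 0 := by
    rintro rfl
    rw [inner_zero_right] at h3
    linarith
  have hn0 : 0 < ‖v‖ := norm_pos_iff.mpr hv0
  have hn1 : ‖v‖ < 1 := by
    rw [real_inner_self_eq_norm_sq] at hv
    nlinarith
  have hi : 1 < ‖v‖⁻¹ := (one_lt_inv₀ hn0).mpr hn1
  have hq : ‖‖v‖⁻¹ • v‖ = 1 := by
    rw [norm_smul, norm_inv, norm_norm, inv_mul_cancel₀ hn0.ne']
  have hmin := hp.2 _ hq
  have mono : ∀ x : E3, |⟪x, p⟫| ≤ ⟪x, v⟫ → dS x (‖v‖⁻¹ • v) ≤ dS x p := by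
    intro x hx
    unfold dS
    apply Real.sqrt_le_sqrt
    rw [inner_smul_right, ← sq_abs ⟪x, p⟫]
    have h0 := abs_nonneg ⟪x, p⟫
    have : |⟪x, p⟫| ≤ ‖v‖⁻¹ * ⟪x, v⟫ := by nlinarith
    nlinarith
  have strict : dS c (‖v‖⁻¹ • v) < dS c p := by
    unfold dS
    apply Real.sqrt_lt_sqrt
    · have := abs_real_inner_le_norm c (‖v‖⁻¹ • v)
      rw [hc, hq, mul_one] at this
      have := (sq_le_one_iff_abs_le_one _).mpr this
      linarith
    · rw [inner_smul_right, ← sq_abs ⟪c, p⟫]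
      have : |⟪c, p⟫| < ‖v‖⁻¹ * ⟪c, v⟫ := by nlinarith
      nlinarith
  have m1 := mono a h1
  have m2 := mono b h2
  unfold J at hmin
  linarith

set_option maxHeartbeats 1000000 in
/-- Second construction: the vector in the span of `a` and `c`. -/
theorem case_two (a b c p : E3) (x y z : ℝ)
    (ha : ⟪a, a⟫ = 1) (hc : ⟪c, c⟫ = 1) (hpp : ⟪p, p⟫ = 1)
    (hab : ⟪a, b⟫ = x) (hac : ⟪a, c⟫ = y) (hbc : ⟪b, c⟫ = z)
    (hx : 0 < x) (hy : 0 < y) (hz : 0 < z)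
    (hx1 : x ^ 2 < 1) (hy1 : y ^ 2 < 1)
    (hD : 0 < 1 + 2 * x * y * z - x ^ 2 - y ^ 2 - z ^ 2)
    (hA : 0 < ⟪a, p⟫) (hB : 0 ≤ ⟪b, p⟫) (hC : ⟪c, p⟫ < 0)
    (hg : 0 ≤ x * z - y)
    (hX : 0 ≤ (x * z - y) * ⟪a, p⟫ + (x * y - z) * ⟪b, p⟫) :
    ∃ v : E3, |⟪a, p⟫| ≤ ⟪a, v⟫ ∧ |⟪b, p⟫| ≤ ⟪b, v⟫ ∧ |⟪c, p⟫| ≤ ⟪c, v⟫ ∧ ⟪v, v⟫ < 1 := by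
  obtain ⟨α, hα⟩ : ∃ α, ⟪a, p⟫ = α := ⟨_, rfl⟩
  obtain ⟨β, hβ⟩ : ∃ β, ⟪b, p⟫ = β := ⟨_, rfl⟩
  obtain ⟨γ, hγ⟩ : ∃ γ, ⟪c, p⟫ = -γ := ⟨-⟪c, p⟫, by ring⟩
  rw [hα] at hA hX
  rw [hβ] at hB hX
  rw [hγ] at hC
  have hγ0 : 0 < γ := by linarith
  have hs : 0 < 1 - y ^ 2 := by linarith
  have hca : ⟪c, a⟫ = y := by rw [real_inner_comm]; exact hac
  have hba : ⟪b, a⟫ = x := by rw [real_inner_comm]; exact hab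
  have hpa : ⟪p, a⟫ = α := by rw [real_inner_comm]; exact hα
  have hpc : ⟪p, c⟫ = -γ := by rw [real_inner_comm]; exact hγ
  have hp2 : 0 ≤ (1 - y ^ 2) - (α ^ 2 + γ ^ 2 + 2 * α * γ * y) := by
    have h := real_inner_self_nonneg
      (x := (1 - y ^ 2) • p - (α + γ * y) • a + (γ + α * y) • c)
    have e : ⟪(1 - y ^ 2) • p - (α + γ * y) • a + (γ + α * y) • c,
        (1 - y ^ 2) • p - (α + γ * y) • a + (γ + α * y) • c⟫
        = (1 - y ^ 2) * ((1 - y ^ 2) - (α ^ 2 + γ ^ 2 + 2 * α * γ * y)) := by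
      simp only [inner_add_left, inner_add_right, inner_sub_left, inner_sub_right,
        real_inner_smul_left, real_inner_smul_right, ha, hc, hpp, hac, hca, hα, hγ, hpa, hpc]
      ring
    rw [e] at h
    exact nonneg_of_mul_nonneg_right h hs
  refine ⟨((α - γ * y) / (1 - y ^ 2)) • a + ((γ - α * y) / (1 - y ^ 2)) • c, ?_, ?_, ?_, ?_⟩
  · rw [hα, abs_of_pos hA]
    simp only [inner_add_right, real_inner_smul_right, ha, hac]
    apply le_of_eq
    field_simp
    ring
  · rw [hβ, abs_of_nonneg hB]
    simp only [inner_add_right, real_inner_smul_right, hba, hbc]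
    have e : (α - γ * y) / (1 - y ^ 2) * x + (γ - α * y) / (1 - y ^ 2) * z
        = (α * (x - y * z) + γ * (z - x * y)) / (1 - y ^ 2) := by
      field_simp
      ring
    rw [e, le_div_iff₀ hs]
    have hzxy : 0 < z - x * y := by nlinarith
    -- multiply by `z - x y`
    have k1 : β * (z - x * y) ≤ α * (x * z - y) := by linarith
    have k2 : (x * z - y) * (1 - y ^ 2) ≤ (x - y * z) * (z - x * y) := by
      nlinarith [mul_pos hy hD]
    have k3 : β * (1 - y ^ 2) * (z - x * y) ≤ α * (x - y * z) * (z - x * y) := by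
      nlinarith [mul_le_mul_of_nonneg_right k1 hs.le, mul_le_mul_of_nonneg_left k2 hA.le]
    have k4 := le_of_mul_le_mul_right k3 hzxy
    nlinarith [mul_pos hγ0 hzxy]
  · rw [hγ, abs_neg, abs_of_pos hγ0]
    simp only [inner_add_right, real_inner_smul_right, hca, hc]
    apply le_of_eq
    field_simp
    ring
  · have e1 : (α - γ * y) / (1 - y ^ 2) * 1 + (γ - α * y) / (1 - y ^ 2) * y = α := by
      field_simp
      ring
    have e2 : (α - γ * y) / (1 - y ^ 2) * y + (γ - α * y) / (1 - y ^ 2) * 1 = γ := by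
      field_simp
      ring
    rw [inner_add_left, real_inner_smul_left, real_inner_smul_left, inner_add_right,
      inner_add_right, real_inner_smul_right, real_inner_smul_right, real_inner_smul_right,
      real_inner_smul_right, ha, hc, hac, hca, e1, e2, div_mul_eq_mul_div, div_mul_eq_mul_div,
      ← add_div, div_lt_one hs]
    nlinarith [mul_pos (mul_pos hA hγ0) hy]

/-- First construction: flip the sign of the inner product with `c`. -/
theorem case_one (a b c p : E3) (x y z : ℝ)
    (ha : ⟪a, a⟫ = 1) (hb : ⟪b, b⟫ = 1) (hc : ⟪c, c⟫ = 1) (hpp : ⟪p, p⟫ = 1)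
    (hab : ⟪a, b⟫ = x) (hac : ⟪a, c⟫ = y) (hbc : ⟪b, c⟫ = z)
    (hD : 0 < 1 + 2 * x * y * z - x ^ 2 - y ^ 2 - z ^ 2)
    (hA : 0 ≤ ⟪a, p⟫) (hB : 0 ≤ ⟪b, p⟫) (hC : ⟪c, p⟫ < 0)
    (hX : (x * z - y) * ⟪a, p⟫ + (x * y - z) * ⟪b, p⟫ < 0) :
    ∃ v : E3, |⟪a, p⟫| ≤ ⟪a, v⟫ ∧ |⟪b, p⟫| ≤ ⟪b, v⟫ ∧ |⟪c, p⟫| ≤ ⟪c, v⟫ ∧ ⟪v, v⟫ < 1 := by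
  obtain ⟨α, hα⟩ : ∃ α, ⟪a, p⟫ = α := ⟨_, rfl⟩
  obtain ⟨β, hβ⟩ : ∃ β, ⟪b, p⟫ = β := ⟨_, rfl⟩
  obtain ⟨γ, hγ⟩ : ∃ γ, ⟪c, p⟫ = -γ := ⟨-⟪c, p⟫, by ring⟩
  rw [hα] at hA hX
  rw [hβ] at hB hX
  rw [hγ] at hC
  have hγ0 : 0 < γ := by linarith
  have hca : ⟪c, a⟫ = y := by rw [real_inner_comm]; exact hac
  have hba : ⟪b, a⟫ = x := by rw [real_inner_comm]; exact hab
  have hcb : ⟪c, b⟫ = z := by rw [real_inner_comm]; exact hbc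
  have hpa : ⟪p, a⟫ = α := by rw [real_inner_comm]; exact hα
  have hpb : ⟪p, b⟫ = β := by rw [real_inner_comm]; exact hβ
  have hpc : ⟪p, c⟫ = -γ := by rw [real_inner_comm]; exact hγ
  obtain ⟨D, hDe⟩ : ∃ D, 1 + 2 * x * y * z - x ^ 2 - y ^ 2 - z ^ 2 = D := ⟨_, rfl⟩
  rw [hDe] at hD
  obtain ⟨w, hw⟩ : ∃ w : E3, w = (x * z - y) • a + (x * y - z) • b + (1 - x ^ 2) • c := ⟨_, rfl⟩
  have haw : ⟪a, w⟫ = 0 := by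
    rw [hw]
    simp only [inner_add_right, real_inner_smul_right, ha, hab, hac]
    ring
  have hbw : ⟪b, w⟫ = 0 := by
    rw [hw]
    simp only [inner_add_right, real_inner_smul_right, hb, hba, hbc]
    ring
  have hcw : ⟪c, w⟫ = D := by
    rw [hw, ← hDe]
    simp only [inner_add_right, real_inner_smul_right, hc, hca, hcb]
    ring
  have hww : ⟪w, w⟫ = (1 - x ^ 2) * D := by
    nth_rewrite 1 [hw]
    simp only [inner_add_left, real_inner_smul_left, haw, hbw, hcw]
    ring
  have hpw : ⟪p, w⟫ = (x * z - y) * α + (x * y - z) * β - (1 - x ^ 2) * γ := by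
    rw [hw]
    simp only [inner_add_right, real_inner_smul_right, hpa, hpb, hpc]
    ring
  have hwp : ⟪w, p⟫ = (x * z - y) * α + (x * y - z) * β - (1 - x ^ 2) * γ := by
    rw [real_inner_comm]; exact hpw
  refine ⟨p + (2 * γ / D) • w, ?_, ?_, ?_, ?_⟩
  · rw [inner_add_right, real_inner_smul_right, haw, hα, abs_of_nonneg hA]
    simp
  · rw [inner_add_right, real_inner_smul_right, hbw, hβ, abs_of_nonneg hB]
    simp
  · rw [inner_add_right, real_inner_smul_right, hcw, hγ, abs_neg, abs_of_pos hγ0,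
      div_mul_cancel₀ _ hD.ne']
    linarith
  · simp only [inner_add_left, inner_add_right, real_inner_smul_left, real_inner_smul_right,
      hpp, hpw, hwp, hww]
    have k : 0 < 4 * γ / D * -((x * z - y) * α + (x * y - z) * β) :=
      mul_pos (by positivity) (by linarith)
    have e : 2 * γ / D * (2 * γ / D * ((1 - x ^ 2) * D))
        = 4 * γ / D * ((1 - x ^ 2) * γ) := by
      field_simp
      ring
    rw [e]
    have e2 : 4 * γ / D = 2 * (2 * γ / D) := by ring
    rw [e2] at k ⊢
    linarith

theorem no_mixed (a b c p : E3) (ha : ‖a‖ = 1) (hb : ‖b‖ = 1) (hc : ‖c‖ = 1)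
    (hab : 0 < ⟪a, b⟫) (hac : 0 < ⟪a, c⟫) (hbc : 0 < ⟪b, c⟫)
    (h1 : ⟪a, b⟫ ^ 2 < 1) (h2 : ⟪a, c⟫ ^ 2 < 1) (h3 : ⟪b, c⟫ ^ 2 < 1)
    (hD : 0 < 1 + 2 * ⟪a, b⟫ * ⟪a, c⟫ * ⟪b, c⟫ - ⟪a, b⟫ ^ 2 - ⟪a, c⟫ ^ 2 - ⟪b, c⟫ ^ 2)
    (hp : IsMinimizer a b c p) (hA : 0 ≤ ⟪a, p⟫) (hB : 0 ≤ ⟪b, p⟫) (hC : ⟪c, p⟫ < 0)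
    (hAB : 0 < ⟪a, p⟫ ∨ 0 < ⟪b, p⟫) : False := by
  have sq1 : ∀ u : E3, ‖u‖ = 1 → ⟪u, u⟫ = 1 := by
    intro u hu
    rw [real_inner_self_eq_norm_sq, hu]; norm_num
  suffices h : ∃ v : E3, |⟪a, p⟫| ≤ ⟪a, v⟫ ∧ |⟪b, p⟫| ≤ ⟪b, v⟫ ∧ |⟪c, p⟫| ≤ ⟪c, v⟫ ∧
      ⟪v, v⟫ < 1 by
    obtain ⟨v, k1, k2, k3, k4⟩ := h
    exact improve a b c p v hc hp k1 k2 k3 hC k4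
  by_cases hX : (⟪a, b⟫ * ⟪b, c⟫ - ⟪a, c⟫) * ⟪a, p⟫ + (⟪a, b⟫ * ⟪a, c⟫ - ⟪b, c⟫) * ⟪b, p⟫ < 0
  · exact case_one a b c p _ _ _ (sq1 a ha) (sq1 b hb) (sq1 c hc) (sq1 p hp.1) rfl rfl rfl hD
      hA hB hC hX
  · push Not at hX
    by_cases hg : 0 < ⟪a, p⟫ ∧ 0 ≤ ⟪a, b⟫ * ⟪b, c⟫ - ⟪a, c⟫
    · exact case_two a b c p _ _ _ (sq1 a ha) (sq1 c hc) (sq1 p hp.1) rfl rfl rfl hab hac hbc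
        h1 h2 hD hg.1 hB hC hg.2 hX
    · have hg' : 0 < ⟪b, p⟫ ∧ 0 ≤ ⟪a, b⟫ * ⟪a, c⟫ - ⟪b, c⟫ := by
        by_contra hn
        rw [not_and, not_le] at hg hn
        rcases hAB with h | h
        · have t1 := mul_neg_of_neg_of_pos (hg h) h
          rcases hB.eq_or_lt with h0 | h0
          · rw [← h0] at hX; linarith
          · have t2 := mul_neg_of_neg_of_pos (hn h0) h0
            linarith
        · have t1 := mul_neg_of_neg_of_pos (hn h) h
          rcases hA.eq_or_lt with h0 | h0
          · rw [← h0] at hX; linarith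
          · have t2 := mul_neg_of_neg_of_pos (hg h0) h0
            linarith
      obtain ⟨v, k1, k2, k3, k4⟩ := case_two b a c p ⟪a, b⟫ ⟪b, c⟫ ⟪a, c⟫
        (sq1 b hb) (sq1 c hc) (sq1 p hp.1)
        (real_inner_comm _ _) rfl rfl hab hbc hac h1 h3 (by linarith) hg'.1 hA hC hg'.2
        (by linarith)
      exact ⟨v, k2, k1, k3, k4⟩

theorem pair_lt (a b : E3) (ha : ‖a‖ = 1) (hb : ‖b‖ = 1)
    (hli : LinearIndependent ℝ ![a, b]) : ⟪a, b⟫ ^ 2 < 1 := by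
  have hne : b - ⟪a, b⟫ • a ≠ 0 := by
    intro h
    have := (LinearIndependent.pair_iff.mp hli) (-⟪a, b⟫) 1 (by rw [← h]; module)
    exact one_ne_zero this.2
  have h := real_inner_self_pos.mpr hne
  have ha' : ⟪a, a⟫ = 1 := by rw [real_inner_self_eq_norm_sq, ha]; norm_num
  have hb' : ⟪b, b⟫ = 1 := by rw [real_inner_self_eq_norm_sq, hb]; norm_num
  simp only [inner_sub_left, inner_sub_right, real_inner_smul_left, real_inner_smul_right,
    ha', hb', real_inner_comm a b] at h
  nlinarith

theorem signs (a b c p : E3) (ha : ‖a‖ = 1) (hb : ‖b‖ = 1) (hc : ‖c‖ = 1)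
    (hab : 0 < ⟪a, b⟫) (hac : 0 < ⟪a, c⟫) (hbc : 0 < ⟪b, c⟫)
    (h1 : ⟪a, b⟫ ^ 2 < 1) (h2 : ⟪a, c⟫ ^ 2 < 1) (h3 : ⟪b, c⟫ ^ 2 < 1)
    (hD : 0 < 1 + 2 * ⟪a, b⟫ * ⟪a, c⟫ * ⟪b, c⟫ - ⟪a, b⟫ ^ 2 - ⟪a, c⟫ ^ 2 - ⟪b, c⟫ ^ 2)
    (hp : IsMinimizer a b c p) (hA : 0 ≤ ⟪a, p⟫) (hB : 0 ≤ ⟪b, p⟫) :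
    (0 ≤ ⟪a, p⟫ ∧ 0 ≤ ⟪b, p⟫ ∧ 0 ≤ ⟪c, p⟫) ∨ (⟪a, p⟫ ≤ 0 ∧ ⟪b, p⟫ ≤ 0 ∧ ⟪c, p⟫ ≤ 0) := by
  rcases le_or_gt 0 ⟪c, p⟫ with h | h
  · exact Or.inl ⟨hA, hB, h⟩
  · right
    by_contra hn
    apply no_mixed a b c p ha hb hc hab hac hbc h1 h2 h3 hD hp hA hB h
    by_contra hm
    push Not at hm
    exact hn ⟨hm.1, hm.2, h.le⟩

theorem signs_two (a b c p : E3) (ha : ‖a‖ = 1) (hb : ‖b‖ = 1) (hc : ‖c‖ = 1)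
    (hab : 0 < ⟪a, b⟫) (hac : 0 < ⟪a, c⟫) (hbc : 0 < ⟪b, c⟫)
    (h1 : ⟪a, b⟫ ^ 2 < 1) (h2 : ⟪a, c⟫ ^ 2 < 1) (h3 : ⟪b, c⟫ ^ 2 < 1)
    (hD : 0 < 1 + 2 * ⟪a, b⟫ * ⟪a, c⟫ * ⟪b, c⟫ - ⟪a, b⟫ ^ 2 - ⟪a, c⟫ ^ 2 - ⟪b, c⟫ ^ 2)
    (hp : IsMinimizer a b c p)
    (hs : (0 ≤ ⟪a, p⟫ ∧ 0 ≤ ⟪b, p⟫) ∨ (⟪a, p⟫ ≤ 0 ∧ ⟪b, p⟫ ≤ 0)) :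
    (0 ≤ ⟪a, p⟫ ∧ 0 ≤ ⟪b, p⟫ ∧ 0 ≤ ⟪c, p⟫) ∨ (⟪a, p⟫ ≤ 0 ∧ ⟪b, p⟫ ≤ 0 ∧ ⟪c, p⟫ ≤ 0) := by
  rcases hs with hs | hs
  · exact signs a b c p ha hb hc hab hac hbc h1 h2 h3 hD hp hs.1 hs.2
  · have hp' : IsMinimizer a b c (-p) := by
      refine ⟨by rw [norm_neg]; exact hp.1, fun q hq => ?_⟩
      have := hp.2 q hq
      simpa [J, dS, inner_neg_right] using this
    have := signs a b c (-p) ha hb hc hab hac hbc h1 h2 h3 hD hp'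
      (by rw [inner_neg_right]; linarith [hs.1]) (by rw [inner_neg_right]; linarith [hs.2])
    simp only [inner_neg_right, Left.nonneg_neg_iff, Left.neg_nonpos_iff] at this
    exact this.symm

theorem gram_pos (a b c : E3) (ha : ‖a‖ = 1) (hb : ‖b‖ = 1) (hc : ‖c‖ = 1)
    (hli : LinearIndependent ℝ ![a, b, c]) (h1 : ⟪a, b⟫ ^ 2 < 1) :
    0 < 1 + 2 * ⟪a, b⟫ * ⟪a, c⟫ * ⟪b, c⟫ - ⟪a, b⟫ ^ 2 - ⟪a, c⟫ ^ 2 - ⟪b, c⟫ ^ 2 := by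
  obtain ⟨x, hx⟩ : ∃ x, ⟪a, b⟫ = x := ⟨_, rfl⟩
  obtain ⟨y, hy⟩ : ∃ y, ⟪a, c⟫ = y := ⟨_, rfl⟩
  obtain ⟨z, hz⟩ : ∃ z, ⟪b, c⟫ = z := ⟨_, rfl⟩
  have hne : (x * z - y) • a + (x * y - z) • b + (1 - x ^ 2) • c ≠ 0 := by
    intro h
    have := (Fintype.linearIndependent_iff.mp hli) ![x * z - y, x * y - z, 1 - x ^ 2]
      (by simpa [Fin.sum_univ_three] using h) 2
    simp at this
    rw [hx] at h1
    linarith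
  have h := real_inner_self_pos.mpr hne
  have hca : ⟪c, a⟫ = y := by rw [real_inner_comm]; exact hy
  have hba : ⟪b, a⟫ = x := by rw [real_inner_comm]; exact hx
  have hcb : ⟪c, b⟫ = z := by rw [real_inner_comm]; exact hz
  have ha' : ⟪a, a⟫ = 1 := by rw [real_inner_self_eq_norm_sq, ha]; norm_num
  have hb' : ⟪b, b⟫ = 1 := by rw [real_inner_self_eq_norm_sq, hb]; norm_num
  have hc' : ⟪c, c⟫ = 1 := by rw [real_inner_self_eq_norm_sq, hc]; norm_num
  simp only [inner_add_left, inner_add_right, real_inner_smul_left, real_inner_smul_right,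
    ha', hb', hc', hx, hy, hz, hca, hba, hcb] at h
  rw [hx] at h1
  rw [hx, hy, hz]
  have e : 0 < (1 - x ^ 2) * (1 + 2 * x * y * z - x ^ 2 - y ^ 2 - z ^ 2) := by linarith
  exact pos_of_mul_pos_right e (by linarith)

theorem stmt9 (a b c p : EuclideanSpace ℝ (Fin 3))
    (ha : ‖a‖ = 1) (hb : ‖b‖ = 1) (hc : ‖c‖ = 1)
    (hli : LinearIndependent ℝ ![a, b, c])
    (hab : 0 < ⟪a, b⟫) (hac : 0 < ⟪a, c⟫) (hbc : 0 < ⟪b, c⟫)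
    (hp : IsMinimizer a b c p) :
    (0 ≤ ⟪a, p⟫ ∧ 0 ≤ ⟪b, p⟫ ∧ 0 ≤ ⟪c, p⟫) ∨ (⟪a, p⟫ ≤ 0 ∧ ⟪b, p⟫ ≤ 0 ∧ ⟪c, p⟫ ≤ 0) := by
  have hl := Fintype.linearIndependent_iff.mp hli
  have h1 : ⟪a, b⟫ ^ 2 < 1 := by
    apply pair_lt a b ha hb
    rw [LinearIndependent.pair_iff]
    intro s t h
    have := hl ![s, t, 0] (by simpa [Fin.sum_univ_three] using h)
    exact ⟨by simpa using this 0, by simpa using this 1⟩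
  have h2 : ⟪a, c⟫ ^ 2 < 1 := by
    apply pair_lt a c ha hc
    rw [LinearIndependent.pair_iff]
    intro s t h
    have := hl ![s, 0, t] (by simpa [Fin.sum_univ_three] using h)
    exact ⟨by simpa using this 0, by simpa using this 2⟩
  have h3 : ⟪b, c⟫ ^ 2 < 1 := by
    apply pair_lt b c hb hc
    rw [LinearIndependent.pair_iff]
    intro s t h
    have := hl ![0, s, t] (by simpa [Fin.sum_univ_three] using h)
    exact ⟨by simpa using this 1, by simpa using this 2⟩
  have hD := gram_pos a b c ha hb hc hli h1
  have hcb := real_inner_comm b c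
  have hba := real_inner_comm a b
  have hca := real_inner_comm a c
  have hp1 : IsMinimizer a c b p := by
    refine ⟨hp.1, fun q hq => ?_⟩
    have := hp.2 q hq
    unfold J at this ⊢
    linarith
  have hp2 : IsMinimizer b c a p := by
    refine ⟨hp.1, fun q hq => ?_⟩
    have := hp.2 q hq
    unfold J at this ⊢
    linarith
  have t1 := signs_two a b c p ha hb hc hab hac hbc h1 h2 h3 hD hp
  have t2 := signs_two a c b p ha hc hb hac hab (by rw [hcb]; exact hbc) h2 h1
    (by rw [hcb]; exact h3) (by rw [hcb]; linarith) hp1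
  have t3 := signs_two b c a p hb hc ha hbc (by rw [hba]; exact hab) (by rw [hca]; exact hac) h3
    (by rw [hba]; exact h1) (by rw [hca]; exact h2) (by rw [hba, hca]; linarith) hp2
  clear hl hli hp hp1 hp2 hD h1 h2 h3 hcb hba hca hab hac hbc ha hb hc
  generalize ⟪a, p⟫ = α at *
  generalize ⟪b, p⟫ = β at *
  generalize ⟪c, p⟫ = γ at *
  rcases le_total 0 α with u | u <;> rcases le_total 0 β with v | v
  · exact t1 (Or.inl ⟨u, v⟩)
  · rcases le_total 0 γ with w | w
    · rcases t2 (Or.inl ⟨u, w⟩) with h | h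
      · exact Or.inl ⟨h.1, h.2.2, h.2.1⟩
      · exact Or.inr ⟨h.1, h.2.2, h.2.1⟩
    · rcases t3 (Or.inr ⟨v, w⟩) with h | h
      · exact Or.inl ⟨h.2.2, h.1, h.2.1⟩
      · exact Or.inr ⟨h.2.2, h.1, h.2.1⟩
  · rcases le_total 0 γ with w | w
    · rcases t3 (Or.inl ⟨v, w⟩) with h | h
      · exact Or.inl ⟨h.2.2, h.1, h.2.1⟩
      · exact Or.inr ⟨h.2.2, h.1, h.2.1⟩
    · rcases t2 (Or.inr ⟨u, w⟩) with h | h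
      · exact Or.inl ⟨h.1, h.2.2, h.2.1⟩
      · exact Or.inr ⟨h.1, h.2.2, h.2.1⟩
  · exact t1 (Or.inr ⟨u, v⟩)
end

section
/- Let a, b, c be linearly independent unit vectors in ℝ³ and let p be a unit vector that is a minimizer for (a,b,c) such that p ∉ {a, -a, b, -b, c, -c}. Then ⟪a,p⟫ • τ_p(a) + ⟪b,p⟫ • τ_p(b) + ⟪c,p⟫ • τ_p(c) = 0, where for a unit vector x with x ≠ ±p one sets τ_p(x) = (x - ⟪p,x⟫ • p) / Real.sqrt (1 - ⟪p,x⟫^2). -/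
open RealInnerProductSpace

noncomputable def tau (p x : EuclideanSpace ℝ (Fin 3)) : EuclideanSpace ℝ (Fin 3) :=
  (Real.sqrt (1 - ⟪p, x⟫ ^ 2))⁻¹ • (x - ⟪p, x⟫ • p)

lemma one_sub_inner_sq_ne (x p : EuclideanSpace ℝ (Fin 3)) (hx : ‖x‖ = 1) (hp : ‖p‖ = 1)
    (h1 : p ≠ x) (h2 : p ≠ -x) : 1 - ⟪x, p⟫ ^ 2 ≠ 0 := by
  intro h
  have h' : (⟪x, p⟫ - 1) * (⟪x, p⟫ + 1) = 0 := by linarith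
  rcases mul_eq_zero.mp h' with h | h
  · exact h1 ((inner_eq_one_iff_of_norm_eq_one (𝕜 := ℝ) hx hp).mp (by linarith)).symm
  · have h3 : ⟪-x, p⟫ = 1 := by rw [inner_neg_left]; linarith
    exact h2 ((inner_eq_one_iff_of_norm_eq_one (𝕜 := ℝ) (by simpa using hx) hp).mp h3).symm

lemma hasDerivAt_dS_curve (x p u : EuclideanSpace ℝ (Fin 3)) (hpu : ⟪p, u⟫ = 0)
    (h : 1 - ⟪x, p⟫ ^ 2 ≠ 0) :
    HasDerivAt (fun t : ℝ => dS x (Real.cos t • p + Real.sin t • u))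
      (-⟪⟪x, p⟫ • tau p x, u⟫) 0 := by
  have hd : HasDerivAt (fun t : ℝ => 1 - (Real.cos t * ⟪x, p⟫ + Real.sin t * ⟪x, u⟫) ^ 2)
      (-(2 * ⟪x, p⟫ * ⟪x, u⟫)) 0 := by
    have := ((((Real.hasDerivAt_cos 0).mul_const ⟪x, p⟫).add
      ((Real.hasDerivAt_sin 0).mul_const ⟪x, u⟫)).pow 2).const_sub 1
    refine this.congr_deriv ?_
    simp
  have hs := hd.sqrt (by simpa using h)
  have hfun : (fun t : ℝ => dS x (Real.cos t • p + Real.sin t • u)) =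
      fun t : ℝ => Real.sqrt (1 - (Real.cos t * ⟪x, p⟫ + Real.sin t * ⟪x, u⟫) ^ 2) := by
    funext t
    simp only [dS, inner_add_right, real_inner_smul_right]
  rw [hfun]
  convert hs using 1
  simp only [tau, real_inner_smul_left, inner_sub_left, hpu, real_inner_comm x p,
    Real.cos_zero, Real.sin_zero]
  simp only [one_mul, zero_mul, add_zero, mul_zero, sub_zero, real_inner_comm p x, div_eq_mul_inv,
    mul_inv]
  ring

lemma inner_tau_self (x p : EuclideanSpace ℝ (Fin 3)) (hp : ‖p‖ = 1) : ⟪p, tau p x⟫ = 0 := by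
  simp [tau, real_inner_smul_right, inner_sub_right, real_inner_self_eq_norm_sq, hp]

theorem stmt10 (a b c p : EuclideanSpace ℝ (Fin 3))
    (ha : ‖a‖ = 1) (hb : ‖b‖ = 1) (hc : ‖c‖ = 1)
    (hli : LinearIndependent ℝ ![a, b, c])
    (hp : IsMinimizer a b c p)
    (hnotv : p ∉ ({a, -a, b, -b, c, -c} : Set (EuclideanSpace ℝ (Fin 3)))) :
    ⟪a, p⟫ • tau p a + ⟪b, p⟫ • tau p b + ⟪c, p⟫ • tau p c = 0 := by
  obtain ⟨hp1, hmin⟩ := hp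
  simp only [Set.mem_insert_iff, Set.mem_singleton_iff, not_or] at hnotv
  obtain ⟨n1, n2, n3, n4, n5, n6⟩ := hnotv
  set V := ⟪a, p⟫ • tau p a + ⟪b, p⟫ • tau p b + ⟪c, p⟫ • tau p c with hV
  by_contra hne
  have hn : ‖V‖ ≠ 0 := norm_ne_zero_iff.mpr hne
  have hpV : ⟪p, V⟫ = 0 := by
    simp [hV, inner_add_right, real_inner_smul_right, inner_tau_self _ p hp1]
  set u := ‖V‖⁻¹ • V with hu
  have hu1 : ‖u‖ = 1 := by rw [hu, norm_smul, norm_inv, norm_norm, inv_mul_cancel₀ hn]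
  have hpu : ⟪p, u⟫ = 0 := by rw [hu, real_inner_smul_right, hpV, mul_zero]
  have hder := ((hasDerivAt_dS_curve a p u hpu (one_sub_inner_sq_ne a p ha hp1 n1 n2)).add
    (hasDerivAt_dS_curve b p u hpu (one_sub_inner_sq_ne b p hb hp1 n3 n4))).add
    (hasDerivAt_dS_curve c p u hpu (one_sub_inner_sq_ne c p hc hp1 n5 n6))
  have hloc : IsLocalMin (fun t : ℝ => J a b c (Real.cos t • p + Real.sin t • u)) 0 := by
    refine Filter.Eventually.of_forall fun t => ?_
    have hq : ‖Real.cos t • p + Real.sin t • u‖ = 1 := by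
      have h2 : ‖Real.cos t • p + Real.sin t • u‖ ^ 2 = 1 := by
        rw [norm_add_sq_real, norm_smul, norm_smul, hp1, hu1, real_inner_smul_left,
          real_inner_smul_right, hpu]
        simp
      exact (pow_eq_one_iff_of_nonneg (norm_nonneg _) two_ne_zero).mp h2
    simpa using hmin _ hq
  have h0 := hloc.hasDerivAt_eq_zero hder
  have hVu : ⟪V, u⟫ = 0 := by
    rw [hV, inner_add_left, inner_add_left]; linarith
  rw [hu, real_inner_smul_right, real_inner_self_eq_norm_sq] at hVu
  have : ‖V‖⁻¹ * ‖V‖ ^ 2 ≠ 0 := by positivity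
  exact this hVu
end

section
/- Let a, b, c be linearly independent unit vectors in ℝ³ with ⟪a,b⟫ · ⟪a,c⟫ · ⟪b,c⟫ ≤ 0 (a big triangle). Then arccos |⟪a,b⟫| + arccos |⟪a,c⟫| + arccos |⟪b,c⟫| > π; that is, the sum of the three pairwise angles between the lines spanned by a, b, c exceeds 180°. -/
open RealInnerProductSpace

theorem stmt11 (a b c : EuclideanSpace ℝ (Fin 3))
    (ha : ‖a‖ = 1) (hb : ‖b‖ = 1) (hc : ‖c‖ = 1)
    (hli : LinearIndependent ℝ ![a, b, c])
    (hbig : ⟪a, b⟫ * ⟪a, c⟫ * ⟪b, c⟫ ≤ 0) :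
    Real.arccos |⟪a, b⟫| + Real.arccos |⟪a, c⟫| + Real.arccos |⟪b, c⟫| > Real.pi := by
  have hdet := (Matrix.posDef_gram_of_linearIndependent (𝕜 := ℝ) hli).det_pos
  rw [Matrix.det_fin_three] at hdet
  simp [Matrix.gram, ha, hb, hc] at hdet
  rw [real_inner_comm a b, real_inner_comm a c, real_inner_comm b c] at hdet
  have hx : |⟪a, b⟫| ≤ 1 := by simpa [ha, hb] using abs_real_inner_le_norm a b
  have hy : |⟪a, c⟫| ≤ 1 := by simpa [ha, hc] using abs_real_inner_le_norm a c
  have hz : |⟪b, c⟫| ≤ 1 := by simpa [hb, hc] using abs_real_inner_le_norm b c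
  have hp : |⟪a, b⟫| * |⟪a, c⟫| * |⟪b, c⟫| = -(⟪a, b⟫ * ⟪a, c⟫ * ⟪b, c⟫) := by
    rw [← abs_mul, ← abs_mul, abs_of_nonpos hbig]
  have hx2 := sq_abs ⟪a, b⟫
  have hy2 := sq_abs ⟪a, c⟫
  have hz2 := sq_abs ⟪b, c⟫
  have hx0 := abs_nonneg ⟪a, b⟫
  have hy0 := abs_nonneg ⟪a, c⟫
  have hz0 := abs_nonneg ⟪b, c⟫
  generalize ⟪a, b⟫ = x at *
  generalize ⟪a, c⟫ = y at *
  generalize ⟪b, c⟫ = z at *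
  generalize |x| = X at *
  generalize |y| = Y at *
  generalize |z| = Z at *
  by_contra! h
  have h1 : Real.cos (Real.pi - (Real.arccos X + Real.arccos Y)) ≤ Real.cos (Real.arccos Z) := by
    apply Real.cos_le_cos_of_nonneg_of_le_pi (Real.arccos_nonneg _)
    · linarith [Real.arccos_nonneg X, Real.arccos_nonneg Y]
    · linarith
  rw [Real.cos_pi_sub, Real.cos_add, Real.cos_arccos (by linarith) hx,
    Real.cos_arccos (by linarith) hy, Real.cos_arccos (by linarith) hz,
    Real.sin_arccos, Real.sin_arccos, ← Real.sqrt_mul (by nlinarith)] at h1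
  have h2 : √((1 - X ^ 2) * (1 - Y ^ 2)) ≤ Z + X * Y := by linarith
  have h3 := (Real.sqrt_le_left (by positivity)).1 h2
  nlinarith
end

section
/- Let a, b, c be linearly independent unit vectors in ℝ³ with ⟪a,b⟫ · ⟪a,c⟫ · ⟪b,c⟫ ≤ 0 (a big triangle). Then every unit vector p that is a minimizer for (a,b,c) belongs to {a, -a, b, -b, c, -c}. -/
open RealInnerProductSpace

open Filter Topology in
lemma second_order (φ φ' : ℝ → ℝ) (k : ℝ)
    (h : ∀ᶠ t in 𝓝 (0:ℝ), HasDerivAt φ (φ' t) t) (h2 : HasDerivAt φ' k 0)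
    (hmin : ∀ t, φ 0 ≤ φ t) : φ' 0 = 0 ∧ 0 ≤ k := by
  have hm : IsLocalMin φ 0 := Eventually.of_forall hmin
  have h0 : φ' 0 = 0 := hm.hasDerivAt_eq_zero h.self_of_nhds
  refine ⟨h0, ?_⟩
  by_contra hk
  push Not at hk
  have hd : deriv φ =ᶠ[𝓝 0] φ' := h.mono fun t ht => ht.deriv
  have hdd : deriv (deriv φ) 0 = k := by rw [hd.deriv_eq]; exact h2.deriv
  have hM : IsLocalMax φ 0 := by
    apply isLocalMax_of_deriv_deriv_neg
    · rw [hdd]; exact hk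
    · rw [hd.self_of_nhds]; exact h0
    · exact h.self_of_nhds.continuousAt
  have hc : φ =ᶠ[𝓝 0] fun _ => φ 0 := by
    filter_upwards [hM] with t ht
    exact le_antisymm ht (hmin t)
  have : deriv (deriv φ) 0 = 0 := by
    have h1 : deriv φ =ᶠ[𝓝 0] fun _ => 0 := by
      have := hc.deriv
      simpa using this
    rw [h1.deriv_eq]; simp
  rw [this] at hdd
  linarith

open Filter Topology in
lemma sqrt_term (s β γ : ℝ) (hs : 0 < s) :
    (∀ᶠ t in 𝓝 (0:ℝ), HasDerivAt (fun t => Real.sqrt (s ^ 2 + β * t + γ * t ^ 2))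
      ((β + 2 * γ * t) / (2 * Real.sqrt (s ^ 2 + β * t + γ * t ^ 2))) t) ∧
    HasDerivAt (fun t => (β + 2 * γ * t) / (2 * Real.sqrt (s ^ 2 + β * t + γ * t ^ 2)))
      (γ / s - β ^ 2 / (4 * s ^ 3)) 0 := by
  have hq : ∀ t : ℝ, HasDerivAt (fun t => s ^ 2 + β * t + γ * t ^ 2) (β + 2 * γ * t) t := by
    intro t
    have := (((hasDerivAt_id t).const_mul β).const_add (s ^ 2)).add
      (((hasDerivAt_id t).pow 2).const_mul γ)
    exact this.congr_deriv (by simp; ring)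
  have hpos : ∀ᶠ t in 𝓝 (0:ℝ), 0 < s ^ 2 + β * t + γ * t ^ 2 := by
    have hc : ContinuousAt (fun t => s ^ 2 + β * t + γ * t ^ 2) 0 := (hq 0).continuousAt
    apply hc.eventually_const_lt
    simpa using pow_pos hs 2
  have hd : ∀ᶠ t in 𝓝 (0:ℝ), HasDerivAt (fun t => Real.sqrt (s ^ 2 + β * t + γ * t ^ 2))
      ((β + 2 * γ * t) / (2 * Real.sqrt (s ^ 2 + β * t + γ * t ^ 2))) t :=
    hpos.mono fun t ht => (hq t).sqrt ht.ne'
  refine ⟨hd, ?_⟩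
  have e0 : Real.sqrt (s ^ 2 + β * 0 + γ * 0 ^ 2) = s := by
    simp [Real.sqrt_sq hs.le]
  have hnum : HasDerivAt (fun t : ℝ => β + 2 * γ * t) (2 * γ) 0 := by
    simpa using ((hasDerivAt_id (0:ℝ)).const_mul (2 * γ)).const_add β
  have hden := hd.self_of_nhds.const_mul 2
  have := hnum.div hden (by rw [e0]; positivity)
  refine HasDerivAt.congr_deriv this ?_
  rw [e0]
  field_simp
  ring

set_option maxHeartbeats 1000000 in
lemma alg_neg (x y z c1 c2 d s1 s2 s3 : ℝ) (h1 : 0 < s1) (h2 : 0 < s2) (h3 : 0 < s3)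
    (e1 : s1 ^ 2 = 1 - x ^ 2) (e2 : s2 ^ 2 = 1 - y ^ 2) (e3 : s3 ^ 2 = 1 - z ^ 2)
    (f1 : x + y * d + z * c1 = 0) (f2 : x * d + y + z * c2 = 0) (f3 : x * c1 + y * c2 + z = 0)
    (hxz : x ^ 2 ≤ z ^ 2) (hyz : y ^ 2 ≤ z ^ 2) (hxy : x ^ 2 + y ^ 2 < 1) :
    (x ^ 2 - c1 ^ 2) / s1 + (y ^ 2 - c2 ^ 2) / s2 - s3 < 0 := by
  have key : ∀ x y c2 : ℝ, y ^ 2 ≤ z ^ 2 → x ^ 2 + y ^ 2 < 1 →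
      x ^ 2 = y ^ 2 + z ^ 2 + 2 * y * z * c2 → y ^ 2 - c2 ^ 2 < 1 - z ^ 2 := by
    intro x y c2 hyz hxy hx
    have hW : 0 < 1 - z ^ 2 := by rw [← e3]; positivity
    by_contra hcon
    push Not at hcon
    have hYW : 1 - z ^ 2 ≤ y ^ 2 := by nlinarith [sq_nonneg c2]
    have hY : 0 < y ^ 2 := by linarith
    have hneg : 2 * y ^ 2 - (1 - z ^ 2) < -(2 * y * z * c2) := by nlinarith
    have h4 : (2 * y ^ 2 - (1 - z ^ 2)) ^ 2 < (2 * y * z * c2) ^ 2 := by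
      nlinarith
    have h5 : 4 * y ^ 2 * (y ^ 2 - (1 - z ^ 2)) < 4 * y ^ 2 * (z ^ 2 * c2 ^ 2) := by
      nlinarith [sq_nonneg (1 - z ^ 2)]
    have h6 : y ^ 2 - (1 - z ^ 2) < z ^ 2 * c2 ^ 2 := lt_of_mul_lt_mul_left h5 (by positivity)
    nlinarith [sq_nonneg c2]
  have hB : y ^ 2 - c2 ^ 2 < 1 - z ^ 2 := key x y c2 hyz hxy (by linear_combination x * f1 - y * f2 - z * f3)
  have hA : x ^ 2 - c1 ^ 2 < 1 - z ^ 2 :=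
    key y x c1 hxz (by linarith) (by linear_combination y * f2 - x * f1 - z * f3)
  have hAB : (x ^ 2 - c1 ^ 2) + (y ^ 2 - c2 ^ 2) < 1 - z ^ 2 := by
    have : z ^ 2 ≤ (x ^ 2 + y ^ 2) * (c1 ^ 2 + c2 ^ 2) := by
      have hz : z = -(x * c1 + y * c2) := by linarith
      rw [hz]
      nlinarith [sq_nonneg (x * c2 - y * c1)]
    nlinarith [sq_nonneg c1, sq_nonneg c2]
  have ht1 : s3 ≤ s1 := by nlinarith
  have ht2 : s3 ≤ s2 := by nlinarith
  have hfin : ∀ A B t u : ℝ, 0 ≤ t → t ≤ 1 → 0 ≤ u → u ≤ 1 → A < 1 - z ^ 2 → B < 1 - z ^ 2 →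
      A + B < 1 - z ^ 2 → t * A + u * B < 1 - z ^ 2 := by
    intro A B t u ht0 ht1 hu0 hu1 hA hB hAB
    have hW : 0 < 1 - z ^ 2 := by rw [← e3]; positivity
    have tA : t * A ≤ max A 0 := by
      rcases le_total A 0 with a0 | a0
      · exact (mul_nonpos_of_nonneg_of_nonpos ht0 a0).trans (le_max_right _ _)
      · exact (mul_le_of_le_one_left a0 ht1).trans (le_max_left _ _)
    have uB : u * B ≤ max B 0 := by
      rcases le_total B 0 with a0 | a0
      · exact (mul_nonpos_of_nonneg_of_nonpos hu0 a0).trans (le_max_right _ _)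
      · exact (mul_le_of_le_one_left a0 hu1).trans (le_max_left _ _)
    rcases max_cases A 0 with a0 | a0 <;> rcases max_cases B 0 with b0 | b0 <;> linarith
  have := hfin _ _ (s3 / s1) (s3 / s2) (by positivity) ((div_le_one h1).2 ht1) (by positivity)
    ((div_le_one h2).2 ht2) hA hB hAB
  rw [← e3] at this
  have e : (x ^ 2 - c1 ^ 2) / s1 + (y ^ 2 - c2 ^ 2) / s2 - s3 =
    (s3 / s1 * (x ^ 2 - c1 ^ 2) + s3 / s2 * (y ^ 2 - c2 ^ 2) - s3 ^ 2) / s3 := by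
    field_simp
  rw [e]
  exact div_neg_of_neg_of_pos (by linarith) h3

lemma dS_pos_facts (a p : E3) (ha : ‖a‖ = 1) (hp : ‖p‖ = 1) (h1 : p ≠ a) (h2 : p ≠ -a) :
    0 < dS a p ∧ dS a p ^ 2 = 1 - ⟪a, p⟫ ^ 2 := by
  have hle : |⟪a, p⟫| ≤ 1 := by simpa [ha, hp] using abs_real_inner_le_norm a p
  have n1 : ⟪a, p⟫ ≠ 1 := fun h => h1 ((inner_eq_one_iff_of_norm_eq_one ha hp).1 h).symm
  have n2 : ⟪a, p⟫ ≠ -1 := fun h => h2 (by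
    have := (inner_eq_one_iff_of_norm_eq_one (𝕜 := ℝ) (x := -a) (y := p) (by simpa using ha) hp).1
      (by simp [h])
    exact this.symm)
  have hlt : |⟪a, p⟫| < 1 := by
    refine lt_of_le_of_ne hle fun h => ?_
    rcases (abs_eq (by norm_num)).1 h with h | h
    · exact n1 h
    · exact n2 h
  have : ⟪a, p⟫ ^ 2 < 1 := by
    rw [← sq_abs]; nlinarith [abs_nonneg ⟪a, p⟫]
  unfold dS
  exact ⟨Real.sqrt_pos.2 (by linarith), Real.sq_sqrt (by linarith)⟩

lemma dS_scale (a p v : E3) (ha : ‖a‖ = 1) (hp : ‖p‖ = 1) (hv : ⟪p, v⟫ = 0) (t : ℝ) (s : ℝ)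
    (hs : s ^ 2 = 1 - ⟪a, p⟫ ^ 2) (r : ℝ) (hr : 0 < r) (hr2 : r ^ 2 = 1 + ‖v‖ ^ 2 * t ^ 2) :
    r * dS a (r⁻¹ • (p + t • v)) =
      Real.sqrt (s ^ 2 + (-(2 * ⟪a, p⟫ * ⟪a, v⟫)) * t + (‖v‖ ^ 2 - ⟪a, v⟫ ^ 2) * t ^ 2) := by
  unfold dS
  nth_rewrite 1 [← Real.sqrt_sq hr.le]
  rw [← Real.sqrt_mul (by positivity)]
  congr 1
  rw [real_inner_smul_right, inner_add_right, real_inner_smul_right]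
  have : r ^ 2 * (1 - (r⁻¹ * (⟪a, p⟫ + t * ⟪a, v⟫)) ^ 2) = r ^ 2 - (⟪a, p⟫ + t * ⟪a, v⟫) ^ 2 := by
    field_simp
  rw [this, hr2, hs]; ring

open Filter Topology in
lemma crit (a b c p : E3) (ha : ‖a‖ = 1) (hb : ‖b‖ = 1) (hc : ‖c‖ = 1)
    (hm : IsMinimizer a b c p) (s1 s2 s3 : ℝ) (d1 : dS a p = s1) (d2 : dS b p = s2)
    (d3 : dS c p = s3) (h1 : 0 < s1) (h2 : 0 < s2) (h3 : 0 < s3)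
    (e1 : s1 ^ 2 = 1 - ⟪a, p⟫ ^ 2) (e2 : s2 ^ 2 = 1 - ⟪b, p⟫ ^ 2) (e3 : s3 ^ 2 = 1 - ⟪c, p⟫ ^ 2)
    (v : E3) (hv : ⟪p, v⟫ = 0) :
    ⟪a, p⟫ * ⟪a, v⟫ / s1 + ⟪b, p⟫ * ⟪b, v⟫ / s2 + ⟪c, p⟫ * ⟪c, v⟫ / s3 = 0 ∧
    0 ≤ (‖v‖ ^ 2 * ⟪a, p⟫ ^ 2 - ⟪a, v⟫ ^ 2 / s1 ^ 2) / s1 +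
      (‖v‖ ^ 2 * ⟪b, p⟫ ^ 2 - ⟪b, v⟫ ^ 2 / s2 ^ 2) / s2 +
      (‖v‖ ^ 2 * ⟪c, p⟫ ^ 2 - ⟪c, v⟫ ^ 2 / s3 ^ 2) / s3 := by
  obtain ⟨hp, hmin⟩ := hm
  obtain ⟨A1, A2⟩ := sqrt_term s1 (-(2 * ⟪a, p⟫ * ⟪a, v⟫)) (‖v‖ ^ 2 - ⟪a, v⟫ ^ 2) h1
  obtain ⟨B1, B2⟩ := sqrt_term s2 (-(2 * ⟪b, p⟫ * ⟪b, v⟫)) (‖v‖ ^ 2 - ⟪b, v⟫ ^ 2) h2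
  obtain ⟨C1, C2⟩ := sqrt_term s3 (-(2 * ⟪c, p⟫ * ⟪c, v⟫)) (‖v‖ ^ 2 - ⟪c, v⟫ ^ 2) h3
  obtain ⟨R1, R2⟩ := sqrt_term 1 0 (‖v‖ ^ 2) one_pos
  have hJ : J a b c p = s1 + s2 + s3 := by unfold J; rw [d1, d2, d3]
  have hd := ((A1.and B1).and (C1.and R1)).mono fun t ht =>
    ((ht.1.1.add ht.1.2).add ht.2.1).sub (ht.2.2.const_mul (s1 + s2 + s3))
  have hd2 := ((A2.add B2).add C2).sub (R2.const_mul (s1 + s2 + s3))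
  have := second_order _ _ _ hd hd2 (by
    intro t
    have hpos : 0 < 1 + ‖v‖ ^ 2 * t ^ 2 := by positivity
    set r := Real.sqrt (1 ^ 2 + 0 * t + ‖v‖ ^ 2 * t ^ 2) with hr
    have hr0 : 0 < r := by rw [hr]; apply Real.sqrt_pos.2; linarith
    have hr2 : r ^ 2 = 1 + ‖v‖ ^ 2 * t ^ 2 := by
      rw [hr, Real.sq_sqrt (by linarith)]; ring
    have hn : ‖r⁻¹ • (p + t • v)‖ = 1 := by
      have h : ‖p + t • v‖ = r := by
        rw [← sq_eq_sq₀ (norm_nonneg _) hr0.le, hr2, norm_add_sq_real, norm_smul,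
          real_inner_smul_right, hv, hp, mul_pow, Real.norm_eq_abs, sq_abs]
        ring
      rw [norm_smul, h, norm_inv, Real.norm_of_nonneg hr0.le, inv_mul_cancel₀ hr0.ne']
    have hq := mul_le_mul_of_nonneg_left (hmin _ hn) hr0.le
    rw [hJ] at hq
    unfold J at hq
    simp only [mul_add r] at hq
    rw [dS_scale a p v ha hp hv t s1 e1 r hr0 hr2,
      dS_scale b p v hb hp hv t s2 e2 r hr0 hr2, dS_scale c p v hc hp hv t s3 e3 r hr0 hr2] at hq
    simp only [Pi.add_apply, Pi.sub_apply]
    rw [← hr]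
    simp only [mul_zero, add_zero, zero_pow two_ne_zero, one_pow, Real.sqrt_sq h1.le,
      Real.sqrt_sq h2.le, Real.sqrt_sq h3.le, Real.sqrt_one]
    linarith)
  obtain ⟨F, S⟩ := this
  constructor
  · simp only [Pi.add_apply, Pi.sub_apply, mul_zero, add_zero, zero_pow two_ne_zero, one_pow,
      Real.sqrt_sq h1.le, Real.sqrt_sq h2.le, Real.sqrt_sq h3.le, Real.sqrt_one] at F
    have : ∀ x α s : ℝ, -(2 * x * α) / (2 * s) = -(x * α / s) := by
      intro x α s
      rw [neg_div, mul_assoc, mul_div_mul_left _ _ two_ne_zero]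
    rw [this, this, this] at F
    simp at F
    linarith
  · refine S.trans_eq ?_
    have : ∀ x α s : ℝ, 0 < s → s ^ 2 = 1 - x ^ 2 →
        (‖v‖ ^ 2 - α ^ 2) / s - (-(2 * x * α)) ^ 2 / (4 * s ^ 3) =
          (‖v‖ ^ 2 * x ^ 2 - α ^ 2 / s ^ 2) / s + s * ‖v‖ ^ 2 := by
      intro x α s hs e
      have e' : x ^ 2 = 1 - s ^ 2 := by linarith
      field_simp
      rw [e']
      ring
    rw [this _ _ _ h1 e1, this _ _ _ h2 e2, this _ _ _ h3 e3]
    ring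

lemma no_min (a b c p : E3) (ha : ‖a‖ = 1) (hb : ‖b‖ = 1) (hc : ‖c‖ = 1)
    (hm : IsMinimizer a b c p) (h1 : 0 < dS a p) (h2 : 0 < dS b p) (h3 : 0 < dS c p)
    (e1 : dS a p ^ 2 = 1 - ⟪a, p⟫ ^ 2) (e2 : dS b p ^ 2 = 1 - ⟪b, p⟫ ^ 2)
    (e3 : dS c p ^ 2 = 1 - ⟪c, p⟫ ^ 2)
    (hxz : ⟪a, p⟫ ^ 2 ≤ ⟪c, p⟫ ^ 2) (hyz : ⟪b, p⟫ ^ 2 ≤ ⟪c, p⟫ ^ 2)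
    (hxy : ⟪a, p⟫ ^ 2 + ⟪b, p⟫ ^ 2 < 1) : False := by
  have hp := hm.1
  have key := crit a b c p ha hb hc hm _ _ _ rfl rfl rfl h1 h2 h3 e1 e2 e3
  have hperp : ∀ w : E3, ⟪p, w - ⟪w, p⟫ • p⟫ = 0 := by
    intro w
    rw [inner_sub_right, real_inner_smul_right, real_inner_self_eq_norm_sq, hp,
      real_inner_comm]; ring
  have hin : ∀ w u : E3, ⟪w, u - ⟪u, p⟫ • p⟫ = ⟪w, u⟫ - ⟪w, p⟫ * ⟪u, p⟫ := by
    intro w u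
    rw [inner_sub_right, real_inner_smul_right]; ring
  have ka := (key _ (hperp a)).1
  have kb := (key _ (hperp b)).1
  obtain ⟨kc, kc2⟩ := key _ (hperp c)
  have hn : ‖c - ⟪c, p⟫ • p‖ ^ 2 = dS c p ^ 2 := by
    rw [← real_inner_self_eq_norm_sq, hin, inner_sub_left, real_inner_smul_left,
      inner_sub_left, real_inner_smul_left, real_inner_self_eq_norm_sq,
      real_inner_self_eq_norm_sq, hp, hc, real_inner_comm c p, e3]; ring
  rw [hn] at kc2
  simp only [hin, real_inner_self_eq_norm_sq, ha, hb, hc] at ka kb kc kc2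
  rw [real_inner_comm a b, real_inner_comm a c] at ka
  rw [real_inner_comm b c] at kb
  generalize dS a p = s1 at *
  generalize dS b p = s2 at *
  generalize dS c p = s3 at *
  clear key hperp hin hn
  generalize ⟪a, p⟫ = x at *
  generalize ⟪b, p⟫ = y at *
  generalize ⟪c, p⟫ = z at *
  generalize ⟪a, b⟫ = gab at *
  generalize ⟪a, c⟫ = gac at *
  generalize ⟪b, c⟫ = gbc at *
  have hneg := alg_neg x y z ((gac - x * z) / (s1 * s3)) ((gbc - y * z) / (s2 * s3))
    ((gab - x * y) / (s1 * s2)) s1 s2 s3 h1 h2 h3 e1 e2 e3 ?_ ?_ ?_ hxz hyz hxy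
  · have : (s3 ^ 2 * x ^ 2 - (gac - x * z) ^ 2 / s1 ^ 2) / s1 +
        (s3 ^ 2 * y ^ 2 - (gbc - y * z) ^ 2 / s2 ^ 2) / s2 +
        (s3 ^ 2 * z ^ 2 - (1 ^ 2 - z * z) ^ 2 / s3 ^ 2) / s3 =
      s3 ^ 2 * ((x ^ 2 - ((gac - x * z) / (s1 * s3)) ^ 2) / s1 +
        (y ^ 2 - ((gbc - y * z) / (s2 * s3)) ^ 2) / s2 - s3) := by
      have hz : (1 ^ 2 - z * z) = s3 ^ 2 := by rw [e3]; ring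
      have hz2 : z ^ 2 = 1 - s3 ^ 2 := by linarith
      rw [hz, hz2]
      field_simp
      ring
    rw [this] at kc2
    have := mul_neg_of_pos_of_neg (pow_pos h3 2) hneg
    linarith
  · have hz : (1 ^ 2 - x * x) = s1 ^ 2 := by rw [e1]; ring
    rw [hz] at ka
    have : x + y * ((gab - x * y) / (s1 * s2)) + z * ((gac - x * z) / (s1 * s3)) =
      (x * s1 ^ 2 / s1 + y * (gab - y * x) / s2 + z * (gac - z * x) / s3) / s1 := by
      field_simp
    rw [this, ka, zero_div]
  · have hz : (1 ^ 2 - y * y) = s2 ^ 2 := by rw [e2]; ring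
    rw [hz] at kb
    have : x * ((gab - x * y) / (s1 * s2)) + y + z * ((gbc - y * z) / (s2 * s3)) =
      (x * (gab - x * y) / s1 + y * s2 ^ 2 / s2 + z * (gbc - z * y) / s3) / s2 := by
      field_simp
    rw [this, kb, zero_div]
  · have hz : (1 ^ 2 - z * z) = s3 ^ 2 := by rw [e3]; ring
    rw [hz] at kc
    have : x * ((gac - x * z) / (s1 * s3)) + y * ((gbc - y * z) / (s2 * s3)) + z =
      (x * (gac - x * z) / s1 + y * (gbc - y * z) / s2 + z * s3 ^ 2 / s3) / s3 := by
      field_simp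
    rw [this, kc, zero_div]

lemma pair_lt_s12 (a b c p : E3) (ha : ‖a‖ = 1) (hb : ‖b‖ = 1) (hc : ‖c‖ = 1)
    (hli : LinearIndependent ℝ ![a, b, c])
    (hm : IsMinimizer a b c p) (h1 : 0 < dS a p) (h2 : 0 < dS b p) (h3 : 0 < dS c p)
    (e1 : dS a p ^ 2 = 1 - ⟪a, p⟫ ^ 2) (e2 : dS b p ^ 2 = 1 - ⟪b, p⟫ ^ 2)
    (e3 : dS c p ^ 2 = 1 - ⟪c, p⟫ ^ 2)
    (hg : ⟪a, p⟫ * ⟪b, p⟫ * ⟪a, b⟫ ≤ 0) :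
    ⟪a, p⟫ ^ 2 + ⟪b, p⟫ ^ 2 < 1 ∨ ⟪c, p⟫ = 0 := by
  have hp := hm.1
  have key := crit a b c p ha hb hc hm _ _ _ rfl rfl rfl h1 h2 h3 e1 e2 e3
  have hnorm : ‖p - (⟪a, p⟫ • a + ⟪b, p⟫ • b)‖ ^ 2 =
      1 - ⟪a, p⟫ ^ 2 - ⟪b, p⟫ ^ 2 + 2 * (⟪a, p⟫ * ⟪b, p⟫ * ⟪a, b⟫) := by
    rw [norm_sub_sq_real, norm_add_sq_real, inner_add_right, real_inner_smul_right,
      real_inner_smul_right, real_inner_smul_left, real_inner_smul_right, norm_smul, norm_smul,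
      mul_pow, mul_pow, ha, hb, hp, Real.norm_eq_abs, Real.norm_eq_abs, sq_abs, sq_abs,
      real_inner_comm a p, real_inner_comm b p]
    ring
  by_contra hcon
  push Not at hcon
  obtain ⟨hge, hz⟩ := hcon
  have h0 : ‖p - (⟪a, p⟫ • a + ⟪b, p⟫ • b)‖ ^ 2 = 0 :=
    le_antisymm (by rw [hnorm]; linarith) (by positivity)
  have hpe : p = ⟪a, p⟫ • a + ⟪b, p⟫ • b := by
    rw [← sub_eq_zero, ← norm_eq_zero]
    exact pow_eq_zero_iff two_ne_zero |>.1 h0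
  set k1 := ⟪a, p⟫ / dS a p with hk1
  set k2 := ⟪b, p⟫ / dS b p with hk2
  set k3 := ⟪c, p⟫ / dS c p with hk3
  set m := k1 * ⟪a, p⟫ + k2 * ⟪b, p⟫ + k3 * ⟪c, p⟫ with hmm
  set G := k1 • a + k2 • b + k3 • c - m • p with hG
  have hGp : ⟪p, G⟫ = 0 := by
    rw [hG, inner_sub_right, inner_add_right, inner_add_right, real_inner_smul_right,
      real_inner_smul_right, real_inner_smul_right, real_inner_smul_right,
      real_inner_self_eq_norm_sq, hp, real_inner_comm a p, real_inner_comm b p,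
      real_inner_comm c p, hmm]
    ring
  have hG0 : G = 0 := by
    rw [← inner_self_eq_zero (𝕜 := ℝ)]
    have h := (key G hGp).1
    have : ⟪G, G⟫ = k1 * ⟪a, G⟫ + k2 * ⟪b, G⟫ + k3 * ⟪c, G⟫ - m * ⟪p, G⟫ := by
      nth_rewrite 1 [hG]
      rw [inner_sub_left, inner_add_left, inner_add_left, real_inner_smul_left,
        real_inner_smul_left, real_inner_smul_left, real_inner_smul_left]
    rw [this, hGp, hk1, hk2, hk3]
    linear_combination h
  have hlin : (k1 - m * ⟪a, p⟫) • a + (k2 - m * ⟪b, p⟫) • b + k3 • c = 0 := by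
    rw [← hG0, hG]
    nth_rewrite 3 [hpe]
    module
  have := Fintype.linearIndependent_iff.1 hli ![k1 - m * ⟪a, p⟫, k2 - m * ⟪b, p⟫, k3]
    (by simpa [Fin.sum_univ_three] using hlin) 2
  simp only [Matrix.cons_val] at this
  rw [hk3, div_eq_zero_iff] at this
  rcases this with h | h
  · exact hz h
  · exact h3.ne' h

lemma IsMinimizer.rot {a b c p : E3} (h : IsMinimizer a b c p) : IsMinimizer b c a p := by
  refine ⟨h.1, fun q hq => ?_⟩
  have := h.2 q hq
  unfold J at *
  linarith

theorem stmt12 (a b c : EuclideanSpace ℝ (Fin 3))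
    (ha : ‖a‖ = 1) (hb : ‖b‖ = 1) (hc : ‖c‖ = 1)
    (hli : LinearIndependent ℝ ![a, b, c])
    (hbig : ⟪a, b⟫ * ⟪a, c⟫ * ⟪b, c⟫ ≤ 0) :
    ∀ p : EuclideanSpace ℝ (Fin 3), IsMinimizer a b c p →
      p ∈ ({a, -a, b, -b, c, -c} : Set (EuclideanSpace ℝ (Fin 3))) := by
  intro p hm
  by_contra hcon
  simp only [Set.mem_insert_iff, Set.mem_singleton_iff, not_or] at hcon
  obtain ⟨n1, n2, n3, n4, n5, n6⟩ := hcon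
  obtain ⟨h1, e1⟩ := dS_pos_facts a p ha hm.1 n1 n2
  obtain ⟨h2, e2⟩ := dS_pos_facts b p hb hm.1 n3 n4
  obtain ⟨h3, e3⟩ := dS_pos_facts c p hc hm.1 n5 n6
  have X1 : ⟪a, p⟫ ^ 2 < 1 := by nlinarith
  have Y1 : ⟪b, p⟫ ^ 2 < 1 := by nlinarith
  have Z1 : ⟪c, p⟫ ^ 2 < 1 := by nlinarith
  have hli2 : LinearIndependent ℝ ![b, c, a] := by
    have := hli.comp ![1, 2, 0] (by decide)
    convert this using 1
    ext i; fin_cases i <;> rfl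
  have hli3 : LinearIndependent ℝ ![c, a, b] := by
    have := hli.comp ![2, 0, 1] (by decide)
    convert this using 1
    ext i; fin_cases i <;> rfl
  have hpair : ⟪a, p⟫ ^ 2 + ⟪b, p⟫ ^ 2 < 1 ∨ ⟪b, p⟫ ^ 2 + ⟪c, p⟫ ^ 2 < 1 ∨
      ⟪c, p⟫ ^ 2 + ⟪a, p⟫ ^ 2 < 1 := by
    by_cases g1 : ⟪a, p⟫ * ⟪b, p⟫ * ⟪a, b⟫ ≤ 0
    · rcases pair_lt_s12 a b c p ha hb hc hli hm h1 h2 h3 e1 e2 e3 g1 with h | h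
      · exact Or.inl h
      · right; left; rw [h]; linarith
    by_cases g2 : ⟪b, p⟫ * ⟪c, p⟫ * ⟪b, c⟫ ≤ 0
    · rcases pair_lt_s12 b c a p hb hc ha hli2 hm.rot h2 h3 h1 e2 e3 e1 g2 with h | h
      · exact Or.inr (Or.inl h)
      · left; rw [h]; linarith
    by_cases g3 : ⟪c, p⟫ * ⟪a, p⟫ * ⟪c, a⟫ ≤ 0
    · rcases pair_lt_s12 c a b p hc ha hb hli3 hm.rot.rot h3 h1 h2 e3 e1 e2 g3 with h | h
      · exact Or.inr (Or.inr h)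
      · left; rw [h]; linarith
    exfalso
    push Not at g1 g2 g3
    have hpos := mul_pos (mul_pos g1 g2) g3
    rw [real_inner_comm a c] at hpos
    have : ⟪a, p⟫ * ⟪b, p⟫ * ⟪a, b⟫ * (⟪b, p⟫ * ⟪c, p⟫ * ⟪b, c⟫) * (⟪c, p⟫ * ⟪a, p⟫ * ⟪a, c⟫) =
      (⟪a, p⟫ * ⟪b, p⟫ * ⟪c, p⟫) ^ 2 * (⟪a, b⟫ * ⟪a, c⟫ * ⟪b, c⟫) := by ring
    rw [this] at hpos
    exact absurd hpos (not_lt.2 (mul_nonpos_of_nonneg_of_nonpos (sq_nonneg _) hbig))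
  rcases le_total (⟪a, p⟫ ^ 2) (⟪b, p⟫ ^ 2) with o1 | o1
  · rcases le_total (⟪b, p⟫ ^ 2) (⟪c, p⟫ ^ 2) with o2 | o2
    · exact no_min a b c p ha hb hc hm h1 h2 h3 e1 e2 e3 (o1.trans o2) o2
        (by rcases hpair with h | h | h <;> linarith)
    · exact no_min c a b p hc ha hb hm.rot.rot h3 h1 h2 e3 e1 e2 o2 o1
        (by rcases hpair with h | h | h <;> linarith)
  · rcases le_total (⟪a, p⟫ ^ 2) (⟪c, p⟫ ^ 2) with o2 | o2
    · exact no_min a b c p ha hb hc hm h1 h2 h3 e1 e2 e3 o2 (o1.trans o2)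
        (by rcases hpair with h | h | h <;> linarith)
    · exact no_min b c a p hb hc ha hm.rot h2 h3 h1 e2 e3 e1 o1 o2
        (by rcases hpair with h | h | h <;> linarith)
end

section
/- Let a, b, c be linearly independent unit vectors in ℝ³ and let p be a unit vector that is a minimizer for (a,b,c) satisfying ⟪a,p⟫ ≥ 0, ⟪b,p⟫ ≥ 0, ⟪c,p⟫ ≥ 0, ⟪a,p⟫ ≥ ⟪b,p⟫ and ⟪a,p⟫ ≥ ⟪c,p⟫. Then ⟪a,p⟫ > 1/√2; in particular the angle between p and a is less than 45°. -/
open RealInnerProductSpace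

theorem stmt13 (a b c p : EuclideanSpace ℝ (Fin 3))
    (ha : ‖a‖ = 1) (hb : ‖b‖ = 1) (hc : ‖c‖ = 1)
    (hli : LinearIndependent ℝ ![a, b, c])
    (hp : IsMinimizer a b c p)
    (hap : 0 ≤ ⟪a, p⟫) (hbp : 0 ≤ ⟪b, p⟫) (hcp : 0 ≤ ⟪c, p⟫)
    (hab : ⟪b, p⟫ ≤ ⟪a, p⟫) (hac : ⟪c, p⟫ ≤ ⟪a, p⟫) :
    1 / Real.sqrt 2 < ⟪a, p⟫ ∧ Real.arccos ⟪a, p⟫ < Real.pi / 4 := by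
  obtain ⟨hp1, hmin⟩ := hp
  have hup : ∀ x y, dS x y ≤ 1 := by
    intro x y
    unfold dS
    rw [Real.sqrt_le_one]
    nlinarith [sq_nonneg ⟪x, y⟫]
  have haa : dS a a = 0 := by
    unfold dS
    rw [real_inner_self_eq_norm_sq, ha]
    norm_num
  have hJ := hmin a ha
  have hs : (0 : ℝ) < Real.sqrt 2 := by positivity
  have hs2 : Real.sqrt 2 ^ 2 = 2 := Real.sq_sqrt (by norm_num)
  have hi2 : (1 / Real.sqrt 2) ^ 2 = 1 / 2 := by rw [div_pow, hs2]; norm_num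
  have hmain : 1 / Real.sqrt 2 < ⟪a, p⟫ := by
    by_contra hcon
    push Not at hcon
    have hlow : ∀ x : EuclideanSpace ℝ (Fin 3), 0 ≤ ⟪x, p⟫ → ⟪x, p⟫ ≤ ⟪a, p⟫ →
        7 / 10 ≤ dS x p := by
      intro x h0 h1
      unfold dS
      apply Real.le_sqrt_of_sq_le
      have h2 : ⟪x, p⟫ ^ 2 ≤ (1 / Real.sqrt 2) ^ 2 :=
        pow_le_pow_left₀ h0 (h1.trans hcon) 2
      rw [hi2] at h2
      linarith
    have h1 := hlow a hap le_rfl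
    have h2 := hlow b hbp hab
    have h3 := hlow c hcp hac
    have h4 := hup b a
    have h5 := hup c a
    unfold J at hJ
    linarith
  refine ⟨hmain, ?_⟩
  have h4 : Real.arccos (1 / Real.sqrt 2) = Real.pi / 4 := by
    have h : 1 / Real.sqrt 2 = Real.cos (Real.pi / 4) := by
      rw [Real.cos_pi_div_four, div_eq_div_iff hs.ne' (by norm_num)]
      linarith [hs2, sq (Real.sqrt 2)]
    rw [h, Real.arccos_cos (by positivity) (by linarith [Real.pi_pos])]
  rw [← h4]
  apply Real.arccos_lt_arccos
  · have : 0 < 1 / Real.sqrt 2 := by positivity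
    linarith
  · exact hmain
  · have := real_inner_le_norm a p
    rw [ha, hp1] at this
    linarith
end
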